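/- arXiv:2112.06081 — 10 statements merged into one kernel-verified Lean document; each statement's English description precedes it below -/
import Mathlib

section
/- Let ε > 0, t ≥ 0 and d ∈ ℕ. Let g : [0,∞) → ℝ^d be continuous, u : [0,∞) → ℝ be continuously differentiable, and w : [0,∞) → ℝ be continuously differentiable with w(s) > 0 for all s. For 0 ≤ r ≤ s set E(s,r) = exp(−(1/ε²)·∫_r^s w(r') dr') and H(s) = ∫_0^s E(s,r) g(r) dr. Then (1/ε²)·∫_0^t u(s) H(s) ds = ∫_0^t u(s) g(s)/w(s) ds + ∫_0^t (u'(s)/w(s)) H(s) ds − (u(t)/w(t)) H(t) − ∫_0^t (u(s)/w(s)²) H(s) w'(s) ds. -/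
open MeasureTheory intervalIntegral

/-- The primitive of a function continuous on `[0, ∞)` is differentiable on `(0, ∞)`. -/
theorem hasDerivAt_integral_of_continuousOn_Ici {F : Type*} [NormedAddCommGroup F]
    [NormedSpace ℝ F] [CompleteSpace F] {f : ℝ → F} (hf : ContinuousOn f (Set.Ici 0))
    {s : ℝ} (hs : 0 < s) : HasDerivAt (fun x => ∫ r in (0:ℝ)..x, f r) (f s) s := by
  refine integral_hasDerivAt_right ?_ ?_ (hf.continuousAt (Ici_mem_nhds hs))
  · refine (hf.mono ?_).intervalIntegrable
    rw [Set.uIcc_of_le hs.le]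
    exact Set.Icc_subset_Ici_self
  · exact (hf.mono Set.Ioi_subset_Ici_self).stronglyMeasurableAtFilter isOpen_Ioi s hs

/-- The primitive of a function continuous on `[0, ∞)` is continuous on `[0, ∞)`. -/
theorem continuousOn_integral_of_continuousOn_Ici {F : Type*} [NormedAddCommGroup F]
    [NormedSpace ℝ F] {f : ℝ → F} (hf : ContinuousOn f (Set.Ici 0)) :
    ContinuousOn (fun x => ∫ r in (0:ℝ)..x, f r) (Set.Ici 0) := by
  intro x hx
  have hx1 : (0:ℝ) ≤ x + 1 := add_nonneg hx zero_le_one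
  have h : ContinuousOn (fun x => ∫ r in (0:ℝ)..x, f r) (Set.uIcc 0 (x + 1)) := by
    refine continuousOn_primitive_interval ?_
    rw [Set.uIcc_of_le hx1]
    exact (hf.mono Set.Icc_subset_Ici_self).integrableOn_Icc
  rw [Set.uIcc_of_le hx1] at h
  refine (h x ⟨hx, by linarith⟩).mono_of_mem_nhdsWithin ?_
  rw [← Set.Ici_inter_Iic]
  exact Filter.inter_mem self_mem_nhdsWithin
    (mem_nhdsWithin_of_mem_nhds (Iic_mem_nhds (by linarith)))

/-- Integration by parts for `(u / w) • H`, where `H` solves `H' = g - (c * w) • H`,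
`H 0 = 0`. -/
theorem smul_integral_eq_of_hasDerivAt {F : Type*} [NormedAddCommGroup F]
    [NormedSpace ℝ F] [CompleteSpace F] {c t : ℝ} (ht : 0 ≤ t) {g H : ℝ → F}
    {u u' w w' : ℝ → ℝ} (hg : ContinuousOn g (Set.Ici 0))
    (hu : ∀ s ∈ Set.Ici (0:ℝ), HasDerivAt u (u' s) s) (hu' : ContinuousOn u' (Set.Ici 0))
    (hw : ∀ s ∈ Set.Ici (0:ℝ), HasDerivAt w (w' s) s) (hw' : ContinuousOn w' (Set.Ici 0))
    (hw0 : ∀ s ∈ Set.Ici (0:ℝ), w s ≠ 0) (hH : ContinuousOn H (Set.Ici 0)) (hH0 : H 0 = 0)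
    (hHd : ∀ s, 0 < s → HasDerivAt H (g s - (c * w s) • H s) s) :
    c • (∫ s in (0:ℝ)..t, u s • H s)
      = (∫ s in (0:ℝ)..t, (u s / w s) • g s)
        + (∫ s in (0:ℝ)..t, (u' s / w s) • H s)
        - (u t / w t) • H t
        - (∫ s in (0:ℝ)..t, (u s / (w s)^2 * w' s) • H s) := by
  have huc : ContinuousOn u (Set.Ici 0) := fun s hs => (hu s hs).continuousAt.continuousWithinAt
  have hwc : ContinuousOn w (Set.Ici 0) := fun s hs => (hw s hs).continuousAt.continuousWithinAt
  have hint {f : ℝ → F} (hf : ContinuousOn f (Set.Ici 0)) : IntervalIntegrable f volume 0 t := by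
    refine (hf.mono ?_).intervalIntegrable
    rw [Set.uIcc_of_le ht]
    exact Set.Icc_subset_Ici_self
  have i₁ : IntervalIntegrable (fun s => (u s / w s) • g s) volume 0 t :=
    hint ((huc.div hwc hw0).smul hg)
  have i₂ : IntervalIntegrable (fun s => (u' s / w s) • H s) volume 0 t :=
    hint ((hu'.div hwc hw0).smul hH)
  have i₃ : IntervalIntegrable (fun s => (u s / (w s)^2 * w' s) • H s) volume 0 t :=
    hint (((huc.div (hwc.pow 2) fun s hs => pow_ne_zero 2 (hw0 s hs)).mul hw').smul hH)
  have i₄ : IntervalIntegrable (fun s => c • (u s • H s)) volume 0 t :=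
    (hint (huc.smul hH)).smul c
  have hderiv : ∀ s ∈ Set.Ioo 0 t, HasDerivAt (fun s => (u s / w s) • H s)
      ((u s / w s) • g s + (u' s / w s) • H s
        - (u s / (w s)^2 * w' s) • H s - c • (u s • H s)) s := by
    intro s hs
    have hs0 : s ∈ Set.Ici (0:ℝ) := hs.1.le
    have hne := hw0 s hs0
    refine (((hu s hs0).div (hw s hs0) hne).smul (hHd s hs.1)).congr_deriv ?_
    simp only [Pi.div_apply]
    match_scalars <;> field_simp <;> ring
  have key := integral_eq_sub_of_hasDerivAt_of_le (f := fun s => (u s / w s) • H s) ht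
    (((huc.div hwc hw0).smul hH).mono Set.Icc_subset_Ici_self) hderiv
    (((i₁.add i₂).sub i₃).sub i₄)
  rw [integral_sub ((i₁.add i₂).sub i₃) i₄, integral_sub (i₁.add i₂) i₃, integral_add i₁ i₂,
    intervalIntegral.integral_smul] at key
  simp only [hH0, smul_zero, sub_zero] at key
  rw [← key]
  abel

/-- Lemma 3.1 of the paper, smooth `w` case: an
integration-by-parts identity for exponential kernels. -/
theorem stmt0 (ε : ℝ) (hε : 0 < ε) (t : ℝ) (ht : 0 ≤ t) (d : ℕ)
    (g : ℝ → EuclideanSpace ℝ (Fin d)) (u u' w w' : ℝ → ℝ)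
    (hg : ContinuousOn g (Set.Ici 0))
    (hu : ∀ s ∈ Set.Ici (0:ℝ), HasDerivAt u (u' s) s)
    (hu' : ContinuousOn u' (Set.Ici 0))
    (hw : ∀ s ∈ Set.Ici (0:ℝ), HasDerivAt w (w' s) s)
    (hw' : ContinuousOn w' (Set.Ici 0))
    (hwpos : ∀ s ∈ Set.Ici (0:ℝ), 0 < w s)
    (E : ℝ → ℝ → ℝ)
    (hE : ∀ s r : ℝ, E s r = Real.exp (-(1/ε^2) * ∫ r' in r..s, w r'))
    (H : ℝ → EuclideanSpace ℝ (Fin d))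
    (hH : ∀ s : ℝ, H s = ∫ r in (0:ℝ)..s, E s r • g r) :
    (1/ε^2) • (∫ s in (0:ℝ)..t, u s • H s)
      = (∫ s in (0:ℝ)..t, (u s / w s) • g s)
        + (∫ s in (0:ℝ)..t, (u' s / w s) • H s)
        - (u t / w t) • H t
        - (∫ s in (0:ℝ)..t, (u s / (w s)^2 * w' s) • H s) := by
  set c : ℝ := 1 / ε ^ 2
  set W : ℝ → ℝ := fun x => ∫ r in (0:ℝ)..x, w r
  set K : ℝ → EuclideanSpace ℝ (Fin d) := fun x => ∫ r in (0:ℝ)..x, Real.exp (c * W r) • g r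
  have hwc : ContinuousOn w (Set.Ici 0) := fun s hs => (hw s hs).continuousAt.continuousWithinAt
  have hW : ContinuousOn W (Set.Ici 0) := continuousOn_integral_of_continuousOn_Ici hwc
  have hKi : ContinuousOn (fun r => Real.exp (c * W r) • g r) (Set.Ici 0) :=
    (hW.const_mul c).rexp.smul hg
  have hHK : ∀ s ∈ Set.Ici (0:ℝ), H s = Real.exp (-c * W s) • K s := by
    intro s hs
    have hs0 : (0:ℝ) ≤ s := hs
    rw [hH, ← intervalIntegral.integral_smul]
    refine integral_congr fun r hr => ?_
    rw [Set.uIcc_of_le hs0] at hr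
    have hi : ∀ x, 0 ≤ x → IntervalIntegrable w volume 0 x := fun x hx =>
      (hwc.mono (by rw [Set.uIcc_of_le hx]; exact Set.Icc_subset_Ici_self)).intervalIntegrable
    have hsub : ∫ r' in r..s, w r' = W s - W r :=
      (integral_interval_sub_left (hi s hs0) (hi r hr.1)).symm
    simp only [hE, hsub, smul_smul, ← Real.exp_add]
    congr 2
    ring
  have hHc : ContinuousOn H (Set.Ici 0) :=
    ((hW.const_mul (-c)).rexp.smul (continuousOn_integral_of_continuousOn_Ici hKi)).congr hHK
  refine smul_integral_eq_of_hasDerivAt ht hg hu hu' hw hw' (fun s hs => (hwpos s hs).ne') hHc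
    (by rw [hH, integral_same]) fun s hs => ?_
  have hd := ((hasDerivAt_integral_of_continuousOn_Ici hwc hs).const_mul (-c)).exp.smul
    (hasDerivAt_integral_of_continuousOn_Ici hKi hs)
  refine (hd.congr_of_eventuallyEq (Filter.eventuallyEq_of_mem (Ici_mem_nhds hs) hHK)).congr_deriv ?_
  rw [hHK s hs.le]
  change Real.exp (-c * W s) • Real.exp (c * W s) • g s
    + (Real.exp (-c * W s) * (-c * w s)) • K s = _
  rw [smul_smul, ← Real.exp_add, neg_mul, neg_add_cancel, Real.exp_zero]
  module
end

section
/- Let d ∈ ℕ, ε > 0, κ₀ > 0, Λ₁ ≥ 0, T > 0, x₀, x₁ ∈ ℝ^d. Let f : [0,T] → ℝ^d be continuous and λ : [0,T] → ℝ be continuously differentiable with λ(t) ≥ κ₀ and |λ'(t)| ≤ Λ₁ for all t. Suppose X : [0,T] → ℝ^d is twice continuously differentiable with X(0) = x₀, X'(0) = x₁ and ε²·X''(t) = f(t) − λ(t)·X'(t) for all t, and Z : [0,T] → ℝ^d is differentiable with Z(0) = x₀ and Z'(t) = f(t)/λ(t) for all t. Then for every t ∈ [0,T], |X(t) − Z(t)|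 ≤ ε²·( 2/κ₀ + t·Λ₁/κ₀² )·( |x₁| + sup_{s ∈ [0,t]} |f(s)| / κ₀ ). -/
open MeasureTheory intervalIntegral

/-- Velocity bound for a damped equation `m v' = f - λ v` with `λ ≥ κ > 0` and `‖f‖ ≤ M`. -/
theorem norm_le_of_damped {E : Type*} [NormedAddCommGroup E] [InnerProductSpace ℝ E]
    {m κ M t : ℝ} (hm : 0 < m) (hκ : 0 < κ) (hM : 0 ≤ M) {f v v' : ℝ → E} {lam : ℝ → ℝ}
    (hlb : ∀ s ∈ Set.Icc (0 : ℝ) t, κ ≤ lam s) (hf : ∀ s ∈ Set.Icc (0 : ℝ) t, ‖f s‖ ≤ M)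
    (hv : ∀ s ∈ Set.Icc (0 : ℝ) t, HasDerivAt v (v' s) s)
    (heq : ∀ s ∈ Set.Icc (0 : ℝ) t, m • v' s = f s - lam s • v s) :
    ∀ s ∈ Set.Icc (0 : ℝ) t, ‖v s‖ ≤ ‖v 0‖ + M / κ := by
  intro s hs
  refine le_of_forall_gt_imp_ge_of_dense fun W hW => ?_
  have hMκ : 0 ≤ M / κ := by positivity
  have hv0 := norm_nonneg (v 0)
  have hW0 : 0 < W := by linarith
  have hd : ∀ r ∈ Set.Icc (0 : ℝ) t,
      HasDerivAt (fun r => ‖v r‖ ^ 2) (2 * inner ℝ (v r) (v' r)) r :=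
    fun r hr => (hv r hr).norm_sq
  have key : ‖v s‖ ^ 2 ≤ W ^ 2 := by
    refine image_le_of_deriv_right_lt_deriv_boundary (f := fun r => ‖v r‖ ^ 2)
      (B := fun _ => W ^ 2) (B' := fun _ => 0)
      (fun r hr => (hd r hr).continuousAt.continuousWithinAt)
      (fun r hr => (hd r (Set.Ico_subset_Icc_self hr)).hasDerivWithinAt)
      (by gcongr; linarith) (fun r => hasDerivAt_const r _) (fun r hr hrW => ?_) hs
    have hr' := Set.Ico_subset_Icc_self hr
    have hnorm : ‖v r‖ = W := (sq_eq_sq₀ (norm_nonneg _) hW0.le).1 hrW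
    have h1 : m * inner ℝ (v r) (v' r) = inner ℝ (v r) (f r) - lam r * W ^ 2 := by
      rw [← real_inner_smul_right, heq r hr', inner_sub_right, real_inner_smul_right,
        real_inner_self_eq_norm_sq, hnorm]
    have h2 : inner ℝ (v r) (f r) ≤ W * M :=
      (real_inner_le_norm _ _).trans (by rw [hnorm]; gcongr; exact hf r hr')
    have h3 : M < κ * W := by
      rw [← div_lt_iff₀' hκ]
      linarith
    have h4 : κ * W ^ 2 ≤ lam r * W ^ 2 := by
      gcongr
      exact hlb r hr'
    have h5 : m * inner ℝ (v r) (v' r) < 0 := by nlinarith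
    have h6 : inner ℝ (v r) (v' r) < 0 := neg_of_mul_neg_right h5 hm.le
    linarith
  exact (sq_le_sq₀ (norm_nonneg _) hW0.le).1 key

/-- deterministic Smoluchowski–Kramers comparison (5.12) of the
paper: the solution of `ε²X'' = f − λX'` is within `O(ε²)` of the solution of
`Z' = f/λ` with the same initial position. -/
theorem stmt6 (d : ℕ) (ε κ₀ Λ₁ T : ℝ) (hε : 0 < ε) (hκ : 0 < κ₀) (hΛ : 0 ≤ Λ₁)
    (hT : 0 < T) (x₀ x₁ : EuclideanSpace ℝ (Fin d))
    (f : ℝ → EuclideanSpace ℝ (Fin d)) (hf : ContinuousOn f (Set.Icc 0 T))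
    (lam lam' : ℝ → ℝ)
    (hlam : ∀ t ∈ Set.Icc (0:ℝ) T, HasDerivAt lam (lam' t) t)
    (hlam' : ContinuousOn lam' (Set.Icc 0 T))
    (hlb : ∀ t ∈ Set.Icc (0:ℝ) T, κ₀ ≤ lam t)
    (hlamd : ∀ t ∈ Set.Icc (0:ℝ) T, |lam' t| ≤ Λ₁)
    (X X' X'' : ℝ → EuclideanSpace ℝ (Fin d))
    (hX1 : ∀ t ∈ Set.Icc (0:ℝ) T, HasDerivAt X (X' t) t)
    (hX2 : ∀ t ∈ Set.Icc (0:ℝ) T, HasDerivAt X' (X'' t) t)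
    (hX'' : ContinuousOn X'' (Set.Icc 0 T))
    (hX0 : X 0 = x₀) (hX'0 : X' 0 = x₁)
    (hXeq : ∀ t ∈ Set.Icc (0:ℝ) T, (ε^2) • X'' t = f t - lam t • X' t)
    (Z Z' : ℝ → EuclideanSpace ℝ (Fin d))
    (hZ : ∀ t ∈ Set.Icc (0:ℝ) T, HasDerivAt Z (Z' t) t)
    (hZ0 : Z 0 = x₀)
    (hZeq : ∀ t ∈ Set.Icc (0:ℝ) T, Z' t = (lam t)⁻¹ • f t) :
    ∀ t ∈ Set.Icc (0:ℝ) T,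
      ‖X t - Z t‖ ≤ ε^2 * (2/κ₀ + t * Λ₁ / κ₀^2)
        * (‖x₁‖ + (⨆ s : Set.Icc (0:ℝ) t, ‖f s‖) / κ₀) := by
  intro t ht
  have hsub : Set.Icc (0 : ℝ) t ⊆ Set.Icc 0 T := Set.Icc_subset_Icc_right ht.2
  set M := ⨆ s : Set.Icc (0 : ℝ) t, ‖f s‖ with hM
  have hbdd : BddAbove (Set.range fun s : Set.Icc (0 : ℝ) t => ‖f s‖) := by
    have h := isCompact_Icc.bddAbove_image (hf.mono hsub).norm
    rwa [Set.image_eq_range] at h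
  have hfM : ∀ s ∈ Set.Icc (0 : ℝ) t, ‖f s‖ ≤ M := fun s hs => le_ciSup hbdd ⟨s, hs⟩
  have hM0 : 0 ≤ M := Real.iSup_nonneg fun s => norm_nonneg _
  set V := ‖x₁‖ + M / κ₀ with hV
  have hV0 : 0 ≤ V := by positivity
  have hvel : ∀ s ∈ Set.Icc (0 : ℝ) t, ‖X' s‖ ≤ V := by
    rw [hV, ← hX'0]
    exact norm_le_of_damped (pow_pos hε 2) hκ hM0 (fun s hs => hlb s (hsub hs)) hfM
      (fun s hs => hX2 s (hsub hs)) (fun s hs => hXeq s (hsub hs))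
  have hpos : ∀ s ∈ Set.Icc (0 : ℝ) T, 0 < lam s := fun s hs => hκ.trans_le (hlb s hs)
  -- Integration by parts: the corrected difference has a derivative without `X''`.
  let G : ℝ → EuclideanSpace ℝ (Fin d) := fun s => X s - Z s + (ε ^ 2 * (lam s)⁻¹) • X' s
  have hG : ∀ s ∈ Set.Icc (0 : ℝ) T,
      HasDerivAt G ((ε ^ 2 * (-lam' s / lam s ^ 2)) • X' s) s := by
    intro s hs
    have hne := (hpos s hs).ne'
    have h := ((hX1 s hs).sub (hZ s hs)).add
      ((((hlam s hs).inv hne).const_mul (ε ^ 2)).smul (hX2 s hs))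
    refine h.congr_deriv ?_
    have h1 : (ε ^ 2 * (lam s)⁻¹) • X'' s = (lam s)⁻¹ • f s - X' s := by
      rw [mul_comm, mul_smul, hXeq s hs, smul_sub, inv_smul_smul₀ hne]
    simp only [Pi.inv_apply, h1, hZeq s hs]
    abel
  have hcorr : ∀ s ∈ Set.Icc (0 : ℝ) t, ‖(ε ^ 2 * (lam s)⁻¹) • X' s‖ ≤ ε ^ 2 * κ₀⁻¹ * V := by
    intro s hs
    have hp := hpos s (hsub hs)
    rw [norm_smul, Real.norm_of_nonneg (by positivity)]
    gcongr
    · exact hlb s (hsub hs)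
    · exact hvel s hs
  have hG' : ∀ s ∈ Set.Ico (0 : ℝ) t,
      ‖(ε ^ 2 * (-lam' s / lam s ^ 2)) • X' s‖ ≤ ε ^ 2 * (Λ₁ / κ₀ ^ 2) * V := by
    intro s hs
    have hs' := Set.Ico_subset_Icc_self hs
    have hp := hpos s (hsub hs')
    rw [norm_smul, norm_mul, norm_div, norm_neg, Real.norm_of_nonneg (sq_nonneg ε),
      Real.norm_of_nonneg (sq_nonneg (lam s)), Real.norm_eq_abs]
    gcongr
    · exact hlamd s (hsub hs')
    · exact hlb s (hsub hs')
    · exact hvel s hs'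
  have hdiff : ‖G t - G 0‖ ≤ ε ^ 2 * (Λ₁ / κ₀ ^ 2) * V * (t - 0) :=
    norm_image_sub_le_of_norm_deriv_le_segment'
      (fun s hs => (hG s (hsub hs)).hasDerivWithinAt) hG' t (Set.right_mem_Icc.2 ht.1)
  have hsplit : X t - Z t = (G t - G 0) + (ε ^ 2 * (lam 0)⁻¹) • X' 0
      - (ε ^ 2 * (lam t)⁻¹) • X' t := by
    simp only [G, hX0, hZ0]
    abel
  calc ‖X t - Z t‖
      ≤ ‖G t - G 0‖ + ‖(ε ^ 2 * (lam 0)⁻¹) • X' 0‖ + ‖(ε ^ 2 * (lam t)⁻¹) • X' t‖ := by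
        rw [hsplit]
        exact (norm_sub_le _ _).trans (add_le_add_left (norm_add_le _ _) _)
    _ ≤ ε ^ 2 * (Λ₁ / κ₀ ^ 2) * V * (t - 0) + ε ^ 2 * κ₀⁻¹ * V + ε ^ 2 * κ₀⁻¹ * V :=
        add_le_add (add_le_add hdiff (hcorr 0 (Set.left_mem_Icc.2 ht.1)))
          (hcorr t (Set.right_mem_Icc.2 ht.1))
    _ = ε ^ 2 * (2 / κ₀ + t * Λ₁ / κ₀ ^ 2) * V := by ring
end

section
/- Let d ∈ ℕ, ε > 0, κ₀ > 0, C̃ > 0, x₀, x₁ ∈ ℝ^d. Let F : [0,∞) × ℝ^d → ℝ^d and λ : [0,∞) × ℝ^d → ℝ be continuous with λ(t,x) ≥ κ₀ and |F(t,x)| ≤ C̃·(1 + t + |x|) for all t, x. Suppose X : [0,∞) → ℝ^d is twice continuously differentiable with X(0) = x₀, X'(0) = x₁ and ε²·X''(t) = F(t, X(t)) − λ(t, X(t))·X'(t) for all t ≥ 0. Then for every t ≥ 0, sup_{s ∈ [0,t]} |X(s)| ≤ ( |x₀| + ε²·|x₁|/κ₀ + (C̃/κ₀)·t·(1+t) )·exp(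 C̃·t/κ₀ ). -/
open MeasureTheory intervalIntegral

/-- Upper bound for the right difference quotients of `‖v‖` that keeps track of a damping
coefficient `c`. -/
theorem HasDerivAt.eventually_norm_slope_lt {E : Type*} [NormedAddCommGroup E] [NormedSpace ℝ E]
    {v : ℝ → E} {v' : E} {x : ℝ} (hv : HasDerivAt v v' x) (c : ℝ) {r : ℝ}
    (hr : ‖v' + c • v x‖ - c * ‖v x‖ < r) :
    ∀ᶠ z in nhdsWithin x (Set.Ioi x), (z - x)⁻¹ * (‖v z‖ - ‖v x‖) < r := by
  have hlim : Filter.Tendsto (fun z => ‖slope v x z + c • v x‖ - c * ‖v x‖)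
      (nhdsWithin x (Set.Ioi x)) (nhds (‖v' + c • v x‖ - c * ‖v x‖)) :=
    (((hasDerivWithinAt_iff_tendsto_slope' (Set.self_notMem_Ioi)).1
      hv.hasDerivWithinAt).add_const _).norm.sub_const _
  have hsmall : ∀ᶠ z in nhdsWithin x (Set.Ioi x), (z - x) * c < 1 := by
    have hcont : Continuous fun z : ℝ => (z - x) * c := by fun_prop
    have h := hcont.tendsto x
    simp only [sub_self, zero_mul] at h
    exact nhdsWithin_le_nhds (h.eventually (gt_mem_nhds one_pos))
  filter_upwards [hlim.eventually (gt_mem_nhds hr), hsmall, self_mem_nhdsWithin] with z h1 h2 h3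
  have hz : 0 < z - x := sub_pos.2 h3
  refine lt_of_le_of_lt ?_ h1
  rw [inv_mul_le_iff₀ hz]
  have hdecomp : v z = (z - x) • (slope v x z + c • v x) + (1 - (z - x) * c) • v x := by
    have := sub_smul_slope v x z
    rw [vsub_eq_sub] at this
    rw [smul_add, this, smul_smul, sub_smul 1, one_smul]
    abel
  have hnorm := norm_add_le ((z - x) • (slope v x z + c • v x)) ((1 - (z - x) * c) • v x)
  rw [← hdecomp, norm_smul, norm_smul, Real.norm_of_nonneg hz.le,
    Real.norm_of_nonneg (sub_nonneg.2 h2.le)] at hnorm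
  linarith

/-- An elementary bound for `gronwallBound` on `[0, t]`. -/
theorem gronwallBound_le_add_mul_exp {δ K b s t : ℝ} (hδ : 0 ≤ δ) (hK : 0 < K) (hb : 0 ≤ b)
    (hst : s ≤ t) :
    gronwallBound δ K (K * b) s ≤ (δ + K * t * b) * Real.exp (K * t) := by
  rw [gronwallBound_of_K_ne_0 hK.ne', mul_div_cancel_left₀ _ hK.ne']
  have hmono : Real.exp (K * s) ≤ Real.exp (K * t) := by gcongr
  have hexp : Real.exp (K * t) - 1 ≤ K * t * Real.exp (K * t) := by
    have h := mul_le_mul_of_nonneg_right (Real.add_one_le_exp (-(K * t))) (Real.exp_pos (K * t)).le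
    rw [← Real.exp_add, neg_add_cancel, Real.exp_zero] at h
    linarith
  have h1 := mul_le_mul_of_nonneg_left hmono hδ
  have h2 := mul_le_mul_of_nonneg_left (hexp.trans' (sub_le_sub_right hmono 1)) hb
  linarith

/-- a priori bound (5.2) of the paper with Gronwall's
inequality, under the sublinear growth assumption on `F`. -/
theorem stmt7 (d : ℕ) (ε κ₀ Ctil : ℝ) (hε : 0 < ε) (hκ : 0 < κ₀) (hC : 0 < Ctil)
    (x₀ x₁ : EuclideanSpace ℝ (Fin d))
    (F : ℝ → EuclideanSpace ℝ (Fin d) → EuclideanSpace ℝ (Fin d))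
    (lam : ℝ → EuclideanSpace ℝ (Fin d) → ℝ)
    (hFcont : ContinuousOn (Function.uncurry F) (Set.Ici 0 ×ˢ Set.univ))
    (hlamcont : ContinuousOn (Function.uncurry lam) (Set.Ici 0 ×ˢ Set.univ))
    (hlb : ∀ t : ℝ, 0 ≤ t → ∀ x : EuclideanSpace ℝ (Fin d), κ₀ ≤ lam t x)
    (hgrowth : ∀ t : ℝ, 0 ≤ t → ∀ x : EuclideanSpace ℝ (Fin d),
      ‖F t x‖ ≤ Ctil * (1 + t + ‖x‖))
    (X X' X'' : ℝ → EuclideanSpace ℝ (Fin d))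
    (hX1 : ∀ t ∈ Set.Ici (0:ℝ), HasDerivAt X (X' t) t)
    (hX2 : ∀ t ∈ Set.Ici (0:ℝ), HasDerivAt X' (X'' t) t)
    (hX'' : ContinuousOn X'' (Set.Ici 0))
    (hX0 : X 0 = x₀) (hX'0 : X' 0 = x₁)
    (hXeq : ∀ t ∈ Set.Ici (0:ℝ),
      (ε^2) • X'' t = F t (X t) - lam t (X t) • X' t) :
    ∀ t : ℝ, 0 ≤ t →
      (⨆ s : Set.Icc (0:ℝ) t, ‖X s‖)
        ≤ (‖x₀‖ + ε^2 * ‖x₁‖ / κ₀ + (Ctil / κ₀) * t * (1 + t))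
            * Real.exp (Ctil * t / κ₀) := by
  intro t ht
  set w : ℝ → EuclideanSpace ℝ (Fin d) := fun s => (ε ^ 2 / κ₀) • X' s with hw
  have hε2 : 0 < ε ^ 2 := by positivity
  have hwnorm : ∀ s, ‖w s‖ = ε ^ 2 / κ₀ * ‖X' s‖ := fun s => by
    rw [hw, norm_smul, Real.norm_of_nonneg (by positivity)]
  have hw' : ∀ s ∈ Set.Ici (0 : ℝ), HasDerivAt w ((ε ^ 2 / κ₀) • X'' s) s :=
    fun s hs => (hX2 s hs).fun_const_smul _
  have hforce : ∀ s ∈ Set.Ici (0 : ℝ),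
      (ε ^ 2 / κ₀) • X'' s + (lam s (X s) / ε ^ 2) • w s = κ₀⁻¹ • F s (X s) := by
    intro s hs
    have h : F s (X s) = ε ^ 2 • X'' s + lam s (X s) • X' s := by
      rw [hXeq s hs, sub_add_cancel]
    rw [h, hw, smul_add, smul_smul, smul_smul, smul_smul]
    congr 2 <;> field_simp
  have hcont : ContinuousOn (fun s => ‖X s‖ + ‖w s‖) (Set.Icc 0 t) := fun s hs =>
    ((hX1 s hs.1).continuousAt.norm.add (hw' s hs.1).continuousAt.norm).continuousWithinAt
  have hgronwall := le_gronwallBound_of_liminf_deriv_right_le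
    (f' := fun s => ‖X' s‖ + (‖κ₀⁻¹ • F s (X s)‖ - lam s (X s) / ε ^ 2 * ‖w s‖))
    (δ := ‖x₀‖ + ε ^ 2 * ‖x₁‖ / κ₀) (K := Ctil / κ₀) (ε := Ctil / κ₀ * (1 + t)) hcont
    (by
      intro s hs r hr
      obtain ⟨r₁, hr₁, hr₂⟩ := exists_between (lt_sub_iff_add_lt.2 hr)
      have h1 := (hX1 s hs.1).eventually_norm_slope_lt 0 (r := r₁) (by simpa using hr₁)
      have h2 := (hw' s hs.1).eventually_norm_slope_lt (lam s (X s) / ε ^ 2) (r := r - r₁)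
        (by rw [hforce s hs.1]; linarith)
      refine (h1.and h2).frequently.mono fun z hz => ?_
      have h3 := add_lt_add hz.1 hz.2
      rw [← mul_add, add_sub_cancel, ← add_sub_add_comm] at h3
      exact h3)
    (by rw [hwnorm, hX0, hX'0]; exact le_of_eq (by ring))
    (by
      intro s hs
      have hF : ‖κ₀⁻¹ • F s (X s)‖ ≤ Ctil / κ₀ * (1 + t + ‖X s‖) := by
        rw [norm_smul, Real.norm_of_nonneg (by positivity), div_mul_eq_mul_div, div_eq_inv_mul]
        have h := hgrowth s hs.1 (X s)
        have hst := hs.2.le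
        exact mul_le_mul_of_nonneg_left (h.trans (by gcongr)) (by positivity)
      have hdamp : ‖X' s‖ ≤ lam s (X s) / ε ^ 2 * ‖w s‖ := by
        have h : lam s (X s) / ε ^ 2 * ‖w s‖ = lam s (X s) / κ₀ * ‖X' s‖ := by
          rw [hwnorm]; field_simp
        rw [h]
        exact le_mul_of_one_le_left (norm_nonneg _) ((one_le_div hκ).2 (hlb s hs.1 _))
      have hpos : 0 ≤ Ctil / κ₀ * ‖w s‖ := by positivity
      linarith)
  have : Nonempty (Set.Icc (0 : ℝ) t) := ⟨⟨0, le_rfl, ht⟩⟩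
  refine ciSup_le fun s => ?_
  have h1 := hgronwall s s.2
  have h2 := gronwallBound_le_add_mul_exp (δ := ‖x₀‖ + ε ^ 2 * ‖x₁‖ / κ₀) (K := Ctil / κ₀)
    (b := 1 + t) (by positivity) (by positivity) (by positivity) s.2.2
  rw [sub_zero] at h1
  rw [mul_div_right_comm Ctil t κ₀]
  exact (le_add_of_nonneg_right (norm_nonneg _)).trans (h1.trans h2)
end

section
/- Let d ∈ ℕ, ε > 0, κ₀ > 0, M ≥ 0, T > 0, x₀, x₁ ∈ ℝ^d. Let f : [0,T] → ℝ^d and λ : [0,T] → ℝ be continuous with λ(r) ≥ κ₀ and |f(r)| ≤ M for all r ∈ [0,T]. Suppose X : [0,T] → ℝ^d is twice continuously differentiable with X(0) = x₀, X'(0) = x₁ and ε²·X''(t) = f(t) − λ(t)·X'(t) for all t. Then for all 0 ≤ s ≤ t ≤ T, |X(t) − X(s)| ≤ |x₁|·ε·√((t−s)/κ₀) + (t−s)·M/κ₀. -/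
open MeasureTheory intervalIntegral

/-- Grönwall-type decay: a solution of `c • V' = f - lam • V` with damping at least `κ` and forcing
at most `M` satisfies `‖V u‖ ≤ ‖V 0‖ * exp (-(κ * u / c)) + M / κ`. -/
theorem norm_le_exp_add_of_damped {E : Type*} [NormedAddCommGroup E] [InnerProductSpace ℝ E]
    {c κ M T : ℝ} (hc : 0 < c) (hκ : 0 < κ) (hM : 0 ≤ M)
    {f V V' : ℝ → E} {lam : ℝ → ℝ}
    (hlb : ∀ r ∈ Set.Icc (0 : ℝ) T, κ ≤ lam r)
    (hfb : ∀ r ∈ Set.Icc (0 : ℝ) T, ‖f r‖ ≤ M)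
    (hV : ∀ t ∈ Set.Icc (0 : ℝ) T, HasDerivAt V (V' t) t)
    (heq : ∀ t ∈ Set.Icc (0 : ℝ) T, c • V' t = f t - lam t • V t) :
    ∀ u ∈ Set.Icc (0 : ℝ) T, ‖V u‖ ≤ ‖V 0‖ * Real.exp (-(κ * u / c)) + M / κ := by
  intro u hu
  refine le_of_forall_pos_le_add fun δ hδ => ?_
  set B : ℝ → ℝ := fun u => ‖V 0‖ * Real.exp (-(κ * u / c)) + M / κ + δ with hB
  have hBpos : ∀ u, 0 < B u := fun u => by simp only [hB]; positivity
  have hBderiv : ∀ u, HasDerivAt B ((M - κ * B u + κ * δ) / c) u := by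
    intro u
    have h1 : HasDerivAt (fun u : ℝ => -(κ * u / c)) (-(κ * 1 / c)) u :=
      (((hasDerivAt_id u).const_mul κ).div_const c).neg
    refine (((h1.exp.const_mul ‖V 0‖).add_const (M / κ)).add_const δ).congr_deriv ?_
    simp only [hB]
    field_simp
    ring
  have hsq : ‖V u‖ ^ 2 ≤ B u ^ 2 := by
    refine image_le_of_deriv_right_lt_deriv_boundary (f := fun u => ‖V u‖ ^ 2)
      (f' := fun u => 2 * inner ℝ (V u) (V' u)) (B := fun u => B u ^ 2)
      (B' := fun u => 2 * B u * ((M - κ * B u + κ * δ) / c)) (a := 0) (b := T)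
      ?_ ?_ ?_ ?_ ?_ hu
    · exact fun t ht => ((hV t ht).continuousAt.norm.pow 2).continuousWithinAt
    · exact fun t ht => (hV t ⟨ht.1, ht.2.le⟩).norm_sq.hasDerivWithinAt
    · have : ‖V 0‖ ≤ B 0 := by
        simp only [hB, mul_zero, zero_div, neg_zero, Real.exp_zero, mul_one]
        have : 0 ≤ M / κ := by positivity
        linarith
      exact pow_le_pow_left₀ (norm_nonneg _) this 2
    · intro t
      refine ((hBderiv t).pow 2).congr_deriv ?_
      norm_num
    · intro t ht h
      have htT : t ∈ Set.Icc (0 : ℝ) T := ⟨ht.1, ht.2.le⟩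
      have hn : ‖V t‖ = B t := (pow_left_inj₀ (norm_nonneg _) (hBpos t).le two_ne_zero).1 h
      have hin : c * inner ℝ (V t) (V' t) = inner ℝ (V t) (f t) - lam t * B t ^ 2 := by
        rw [← real_inner_smul_right, heq t htT, inner_sub_right, real_inner_smul_right,
          real_inner_self_eq_norm_sq, hn]
      have hcs : inner ℝ (V t) (f t) ≤ B t * M :=
        (real_inner_le_norm _ _).trans <| by
          rw [hn]; exact mul_le_mul_of_nonneg_left (hfb t htT) (hBpos t).le
      have hl : κ * B t ^ 2 ≤ lam t * B t ^ 2 :=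
        mul_le_mul_of_nonneg_right (hlb t htT) (sq_nonneg _)
      have hpos : 0 < B t * (κ * δ) := mul_pos (hBpos t) (mul_pos hκ hδ)
      have : inner ℝ (V t) (V' t) < B t * (M - κ * B t + κ * δ) / c := by
        rw [lt_div_iff₀ hc]
        linarith
      calc 2 * inner ℝ (V t) (V' t) < 2 * (B t * (M - κ * B t + κ * δ) / c) := by linarith
        _ = _ := by ring
  exact (pow_le_pow_iff_left₀ (norm_nonneg _) (hBpos u).le two_ne_zero).1 hsq

theorem one_sub_exp_neg_le_sqrt {h : ℝ} (hh : 0 ≤ h) : 1 - Real.exp (-h) ≤ √h := by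
  apply Real.le_sqrt_of_sq_le
  have h1 : Real.exp (-h) ≤ 1 := Real.exp_le_one_iff.2 (by linarith)
  have h2 := Real.add_one_le_exp (-h)
  nlinarith [Real.exp_pos (-h)]

/-- The increment of an antiderivative of `exp (-(κ * u / ε ^ 2))` is at most
`ε * √((t - s) / κ)`. -/
theorem exp_increment_le_mul_sqrt {ε κ s t : ℝ} (hε : 0 < ε) (hκ : 0 < κ) (hs : 0 ≤ s)
    (hst : s ≤ t) :
    ε ^ 2 / κ * (Real.exp (-(κ * s / ε ^ 2)) - Real.exp (-(κ * t / ε ^ 2))) ≤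
      ε * √((t - s) / κ) := by
  have hts : 0 ≤ (t - s) / κ := div_nonneg (by linarith) hκ.le
  have hh : κ * (t - s) / ε ^ 2 = (κ / ε) ^ 2 * ((t - s) / κ) := by field_simp
  have hexp : Real.exp (-(κ * t / ε ^ 2)) =
      Real.exp (-(κ * s / ε ^ 2)) * Real.exp (-(κ * (t - s) / ε ^ 2)) := by
    rw [← Real.exp_add]; ring_nf
  have h0 : 0 ≤ κ * (t - s) / ε ^ 2 := by rw [hh]; positivity
  have h1 : Real.exp (-(κ * s / ε ^ 2)) ≤ 1 :=
    Real.exp_le_one_iff.2 (neg_nonpos.2 (by positivity))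
  have h2 : Real.exp (-(κ * (t - s) / ε ^ 2)) ≤ 1 := Real.exp_le_one_iff.2 (by linarith)
  have h3 := one_sub_exp_neg_le_sqrt h0
  calc _ ≤ ε ^ 2 / κ * √(κ * (t - s) / ε ^ 2) := by
        gcongr
        rw [hexp]
        nlinarith
    _ = ε * √((t - s) / κ) := by
        rw [hh, Real.sqrt_mul (sq_nonneg _), Real.sqrt_sq (by positivity)]
        field_simp

/-- modulus-of-continuity estimate (5.3) of the paper. -/
theorem stmt8 (d : ℕ) (ε κ₀ M T : ℝ) (hε : 0 < ε) (hκ : 0 < κ₀) (hM : 0 ≤ M)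
    (hT : 0 < T) (x₀ x₁ : EuclideanSpace ℝ (Fin d))
    (f : ℝ → EuclideanSpace ℝ (Fin d)) (lam : ℝ → ℝ)
    (hf : ContinuousOn f (Set.Icc 0 T)) (hlam : ContinuousOn lam (Set.Icc 0 T))
    (hlb : ∀ r ∈ Set.Icc (0:ℝ) T, κ₀ ≤ lam r)
    (hfb : ∀ r ∈ Set.Icc (0:ℝ) T, ‖f r‖ ≤ M)
    (X X' X'' : ℝ → EuclideanSpace ℝ (Fin d))
    (hX1 : ∀ t ∈ Set.Icc (0:ℝ) T, HasDerivAt X (X' t) t)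
    (hX2 : ∀ t ∈ Set.Icc (0:ℝ) T, HasDerivAt X' (X'' t) t)
    (hX'' : ContinuousOn X'' (Set.Icc 0 T))
    (hX0 : X 0 = x₀) (hX'0 : X' 0 = x₁)
    (hXeq : ∀ t ∈ Set.Icc (0:ℝ) T, (ε^2) • X'' t = f t - lam t • X' t) :
    ∀ s t : ℝ, 0 ≤ s → s ≤ t → t ≤ T →
      ‖X t - X s‖ ≤ ‖x₁‖ * ε * Real.sqrt ((t - s) / κ₀) + (t - s) * M / κ₀ := by
  intro s t hs hst htT
  have hε2 : 0 < ε ^ 2 := by positivity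
  have hV := norm_le_exp_add_of_damped hε2 hκ hM hlb hfb hX2 hXeq
  rw [hX'0] at hV
  set B : ℝ → ℝ := fun u =>
    ‖x₁‖ * (ε ^ 2 / κ₀ * (Real.exp (-(κ₀ * s / ε ^ 2)) - Real.exp (-(κ₀ * u / ε ^ 2)))) +
      (u - s) * M / κ₀ with hB
  have hBderiv : ∀ u, HasDerivAt B (‖x₁‖ * Real.exp (-(κ₀ * u / ε ^ 2)) + M / κ₀) u := by
    intro u
    have h1 : HasDerivAt (fun u : ℝ => -(κ₀ * u / ε ^ 2)) (-(κ₀ * 1 / ε ^ 2)) u :=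
      (((hasDerivAt_id u).const_mul κ₀).div_const (ε ^ 2)).neg
    have h2 := ((h1.exp.const_sub (Real.exp (-(κ₀ * s / ε ^ 2)))).const_mul
      (ε ^ 2 / κ₀)).const_mul ‖x₁‖
    have h3 := ((((hasDerivAt_id u).sub_const s).mul_const M).div_const κ₀)
    refine (h2.add h3).congr_deriv ?_
    field_simp
  have hmem : ∀ u ∈ Set.Icc s t, u ∈ Set.Icc (0 : ℝ) T := fun u hu =>
    ⟨hs.trans hu.1, hu.2.trans htT⟩
  have hmain : ‖X t - X s‖ ≤ B t := by
    refine image_norm_le_of_norm_deriv_right_le_deriv_boundary (f := fun u => X u - X s)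
      (f' := X') (a := s) (b := t) ?_ ?_ ?_ hBderiv ?_ ⟨hst, le_rfl⟩
    · exact fun u hu =>
        ((hX1 u (hmem u hu)).sub_const (X s)).continuousAt.continuousWithinAt
    · exact fun u hu =>
        ((hX1 u (hmem u ⟨hu.1, hu.2.le⟩)).sub_const (X s)).hasDerivWithinAt
    · simp [hB]
    · exact fun u hu => hV u (hmem u ⟨hu.1, hu.2.le⟩)
  refine hmain.trans ?_
  simp only [hB]
  rw [mul_assoc ‖x₁‖ ε]
  exact add_le_add_left
    (mul_le_mul_of_nonneg_left (exp_increment_le_mul_sqrt hε hκ hs hst) (norm_nonneg _)) _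
end

section
/- Let d ∈ ℕ, ε > 0, κ₀, L_F, L_λ > 0, T > 0, x₀, x₁ ∈ ℝ^d. Let F : [0,T] × ℝ^d → ℝ^d and λ : [0,T] × ℝ^d → ℝ be continuous with λ(t,x) ≥ κ₀, |F(t,x) − F(t,x')| ≤ L_F·|x − x'| and |λ(t,x) − λ(t,x')| ≤ L_λ·|x − x'| for all t, x, x'. Let φ : [0,T] → ℝ^d be continuous and set M_φ(t) = sup_{r ∈ [0,t]} |F(r, φ_r)|. Suppose X and X^φ are twice continuously differentiable maps [0,T] → ℝ^d with X(0) = X^φ(0) = x₀, X'(0) = (X^φ)'(0) = x₁, ε²·X''(t) = F(t, X(t)) − λ(t, X(t))·X'(t), and ε²·(X^φ)''(t) = F(t, φ_t) − λ(t, φ_t)·(X^φ)'(t) for all t. Then for every t ∈ [0,T], sup_{s ∈ [0,t]} |X(s) − X^φ(s)| ≤ (L_λ·ε²·|x₁|/κ₀²)·sup_{s ∈ [0,t]} |X(s) − φ_s| + ( L_F/κ₀ + L_λ·M_φ(t)/κ₀² )·∫_0^t sup_{r ∈ [0,s]} |X(r) − φ_r| ds. -/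
open MeasureTheory intervalIntegral

/-- Integrated dissipation estimate for `u' = f - a u` with damping `a ≥ c`. -/
lemma norm_add_mul_integral_norm_le_of_hasDerivAt_damped
    {E : Type*} [NormedAddCommGroup E] [InnerProductSpace ℝ E]
    {u f : ℝ → E} {a : ℝ → ℝ} {c t : ℝ} (hc : 0 ≤ c) (ht : 0 ≤ t)
    (hu : ∀ s ∈ Set.Icc 0 t, HasDerivAt u (f s - a s • u s) s)
    (ha : ∀ s ∈ Set.Icc 0 t, c ≤ a s) (hf : ContinuousOn f (Set.Icc 0 t)) :
    ‖u t‖ + c * ∫ s in (0:ℝ)..t, ‖u s‖ ≤ ‖u 0‖ + ∫ s in (0:ℝ)..t, ‖f s‖ := by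
  have huc : ContinuousOn u (Set.Icc 0 t) := fun s hs =>
    (hu s hs).continuousAt.continuousWithinAt
  have hcu : ContinuousOn (fun s => ‖f s‖ - c * ‖u s‖) (Set.Icc 0 t) :=
    hf.norm.sub (continuousOn_const.mul huc.norm)
  have hfi : IntervalIntegrable (fun s => ‖f s‖) volume 0 t :=
    hf.norm.intervalIntegrable_of_Icc ht
  have hui : IntervalIntegrable (fun s => c * ‖u s‖) volume 0 t :=
    (continuousOn_const.mul huc.norm).intervalIntegrable_of_Icc ht
  have key : ∀ δ : ℝ, 0 < δ →
      ‖u t‖ + c * ∫ s in (0:ℝ)..t, ‖u s‖ ≤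
        (‖u 0‖ + ∫ s in (0:ℝ)..t, ‖f s‖) + δ * (1 + c * t) := by
    intro δ hδ
    set N : ℝ → ℝ := fun s => √(‖u s‖ ^ 2 + δ ^ 2)
    have hpos : ∀ s, 0 < ‖u s‖ ^ 2 + δ ^ 2 := fun s => by positivity
    have hNpos : ∀ s, 0 < N s := fun s => Real.sqrt_pos.2 (hpos s)
    have hNsq : ∀ s, N s ^ 2 = ‖u s‖ ^ 2 + δ ^ 2 := fun s => Real.sq_sqrt (hpos s).le
    have hNge : ∀ s, ‖u s‖ ≤ N s := fun s => Real.le_sqrt_of_sq_le (by nlinarith)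
    have hNle : N 0 ≤ ‖u 0‖ + δ := by
      refine Real.sqrt_le_iff.2 ⟨by positivity, ?_⟩
      nlinarith [mul_nonneg (norm_nonneg (u 0)) hδ.le]
    have hder : ∀ s ∈ Set.Icc 0 t,
        HasDerivAt N ((2 * inner ℝ (u s) (f s - a s • u s)) / (2 * N s)) s := fun s hs =>
      ((hu s hs).norm_sq.add_const (δ ^ 2)).sqrt (hpos s).ne'
    have hbound : ∀ s ∈ Set.Icc 0 t,
        (2 * inner ℝ (u s) (f s - a s • u s)) / (2 * N s) ≤
          (‖f s‖ - c * ‖u s‖) + c * δ := by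
      intro s hs
      rw [div_le_iff₀ (by linarith [hNpos s]), inner_sub_right, real_inner_smul_right,
        real_inner_self_eq_norm_sq]
      have h1 := real_inner_le_norm (u s) (f s)
      have h2 : ‖u s‖ * ‖f s‖ ≤ N s * ‖f s‖ :=
        mul_le_mul_of_nonneg_right (hNge s) (norm_nonneg _)
      have h3 : c * ‖u s‖ ^ 2 ≤ a s * ‖u s‖ ^ 2 :=
        mul_le_mul_of_nonneg_right (ha s hs) (sq_nonneg _)
      have hNδ : δ ≤ N s := Real.le_sqrt_of_sq_le (by nlinarith [sq_nonneg ‖u s‖])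
      have h4 : (‖u s‖ - δ) * N s ≤ ‖u s‖ ^ 2 := by
        nlinarith [hNsq s, hNge s, hNpos s, mul_le_mul_of_nonneg_right (hNge s) (hNpos s).le,
          mul_le_mul_of_nonneg_right hNδ hδ.le, mul_le_mul_of_nonneg_left hNδ (hNpos s).le]
      have h5 := mul_le_mul_of_nonneg_left h4 hc
      nlinarith
    have hint : N t - N 0 ≤ ∫ s in (0:ℝ)..t, ((‖f s‖ - c * ‖u s‖) + c * δ) :=
      sub_le_integral_of_hasDeriv_right_of_le ht
        (fun s hs => (hder s hs).continuousAt.continuousWithinAt)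
        (fun s hs => (hder s (Set.Ioo_subset_Icc_self hs)).hasDerivWithinAt)
        ((hcu.add continuousOn_const).integrableOn_Icc)
        (fun s hs => hbound s (Set.Ioo_subset_Icc_self hs))
    rw [integral_add (hfi.sub hui) intervalIntegrable_const, integral_sub hfi hui,
      intervalIntegral.integral_const_mul, intervalIntegral.integral_const, smul_eq_mul] at hint
    nlinarith [hNge t]
  have hct : 0 < 1 + c * t := by positivity
  refine le_of_forall_pos_le_add fun η hη => ?_
  have := key (η / (1 + c * t)) (by positivity)
  rwa [div_mul_cancel₀ _ hct.ne'] at this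

/-- Pointwise exponential decay estimate for `u' = f - a u` with damping `a ≥ c`. -/
lemma norm_le_exp_mul_add_of_hasDerivAt_damped
    {E : Type*} [NormedAddCommGroup E] [InnerProductSpace ℝ E]
    {u f : ℝ → E} {a : ℝ → ℝ} {c t M : ℝ} (hc : 0 < c) (ht : 0 ≤ t)
    (hu : ∀ s ∈ Set.Icc 0 t, HasDerivAt u (f s - a s • u s) s)
    (ha : ∀ s ∈ Set.Icc 0 t, c ≤ a s) (hf : ContinuousOn f (Set.Icc 0 t))
    (hM : ∀ s ∈ Set.Icc 0 t, ‖f s‖ ≤ M) :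
    ‖u t‖ ≤ Real.exp (-(c * t)) * ‖u 0‖ + M / c := by
  have hM0 : 0 ≤ M := (norm_nonneg _).trans (hM 0 ⟨le_rfl, ht⟩)
  have hexp : ∀ s, HasDerivAt (fun s => Real.exp (c * s)) (Real.exp (c * s) * c) s := fun s => by
    simpa using ((hasDerivAt_id s).const_mul c).exp
  have hexpc : Continuous fun s => Real.exp (c * s) := by fun_prop
  have h := norm_add_mul_integral_norm_le_of_hasDerivAt_damped
    (u := fun s => Real.exp (c * s) • u s) (f := fun s => Real.exp (c * s) • f s)
    (a := fun s => a s - c) le_rfl ht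
    (fun s hs => ((hexp s).smul (hu s hs)).congr_deriv (by module))
    (fun s hs => sub_nonneg.2 (ha s hs)) (hexpc.continuousOn.smul hf)
  have hfi : ∫ s in (0:ℝ)..t, ‖Real.exp (c * s) • f s‖ ≤
      ∫ s in (0:ℝ)..t, M / c * (Real.exp (c * s) * c) := by
    refine integral_mono_on ht ((hexpc.continuousOn.smul hf).norm.intervalIntegrable_of_Icc ht)
      (Continuous.intervalIntegrable (by fun_prop) _ _) fun s hs => ?_
    rw [norm_smul, Real.norm_eq_abs, Real.abs_exp]
    have := mul_le_mul_of_nonneg_left (hM s hs) (Real.exp_pos (c * s)).le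
    rwa [mul_left_comm, div_mul_cancel₀ _ hc.ne']
  have hval : ∫ s in (0:ℝ)..t, M / c * (Real.exp (c * s) * c) =
      M / c * (Real.exp (c * t) - 1) := by
    rw [intervalIntegral.integral_const_mul, integral_eq_sub_of_hasDerivAt (fun s _ => hexp s)
      (Continuous.intervalIntegrable (by fun_prop) _ _)]
    simp
  have hMc : 0 ≤ M / c := by positivity
  have hE := Real.exp_pos (c * t)
  simp only [norm_smul, Real.norm_eq_abs, Real.abs_exp, mul_zero, Real.exp_zero, abs_one,
    one_mul, zero_mul, add_zero] at h hfi
  rw [Real.exp_neg, inv_mul_eq_div, ← sub_le_iff_le_add, le_div_iff₀ hE]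
  nlinarith

/-- A continuous function on a compact interval is bounded by its running supremum. -/
lemma ContinuousOn.le_ciSup_Icc {h : ℝ → ℝ} {t r : ℝ}
    (hh : ContinuousOn h (Set.Icc 0 t)) (hr : r ∈ Set.Icc 0 t) :
    h r ≤ ⨆ s : Set.Icc (0:ℝ) t, h s := by
  have hb : BddAbove (Set.range fun s : Set.Icc (0:ℝ) t => h s) := by
    rw [← Set.image_eq_range]
    exact isCompact_Icc.bddAbove_image hh
  exact le_ciSup hb ⟨r, hr⟩

/-- The running supremum of a continuous function is monotone. -/
lemma ContinuousOn.monotoneOn_ciSup_Icc {h : ℝ → ℝ} {t : ℝ}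
    (hh : ContinuousOn h (Set.Icc 0 t)) :
    MonotoneOn (fun s => ⨆ r : Set.Icc (0:ℝ) s, h r) (Set.Icc 0 t) := by
  intro s hs s' hs' hss'
  have : Nonempty (Set.Icc (0:ℝ) s) := ⟨⟨0, le_rfl, hs.1⟩⟩
  exact ciSup_le fun r => (hh.mono (Set.Icc_subset_Icc_right hs'.2)).le_ciSup_Icc
    ⟨r.2.1, r.2.2.trans hss'⟩

/-- estimate (5.8) of the paper: comparison of the solution of
the fully coupled second-order equation with the solution of the second-order
equation with coefficients frozen along a reference path `φ`. -/
theorem stmt9 (d : ℕ) (ε κ₀ LF Ll T : ℝ) (hε : 0 < ε) (hκ : 0 < κ₀)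
    (hLF : 0 < LF) (hLl : 0 < Ll) (hT : 0 < T)
    (x₀ x₁ : EuclideanSpace ℝ (Fin d))
    (F : ℝ → EuclideanSpace ℝ (Fin d) → EuclideanSpace ℝ (Fin d))
    (lam : ℝ → EuclideanSpace ℝ (Fin d) → ℝ)
    (hFcont : ContinuousOn (Function.uncurry F) (Set.Icc 0 T ×ˢ Set.univ))
    (hlamcont : ContinuousOn (Function.uncurry lam) (Set.Icc 0 T ×ˢ Set.univ))
    (hlb : ∀ t ∈ Set.Icc (0:ℝ) T, ∀ x : EuclideanSpace ℝ (Fin d), κ₀ ≤ lam t x)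
    (hFlip : ∀ t ∈ Set.Icc (0:ℝ) T, ∀ x x' : EuclideanSpace ℝ (Fin d),
      ‖F t x - F t x'‖ ≤ LF * ‖x - x'‖)
    (hlamlip : ∀ t ∈ Set.Icc (0:ℝ) T, ∀ x x' : EuclideanSpace ℝ (Fin d),
      |lam t x - lam t x'| ≤ Ll * ‖x - x'‖)
    (φ : ℝ → EuclideanSpace ℝ (Fin d)) (hφ : ContinuousOn φ (Set.Icc 0 T))
    (X X' X'' Xφ Xφ' Xφ'' : ℝ → EuclideanSpace ℝ (Fin d))
    (hX1 : ∀ t ∈ Set.Icc (0:ℝ) T, HasDerivAt X (X' t) t)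
    (hX2 : ∀ t ∈ Set.Icc (0:ℝ) T, HasDerivAt X' (X'' t) t)
    (hXc : ContinuousOn X'' (Set.Icc 0 T))
    (hXφ1 : ∀ t ∈ Set.Icc (0:ℝ) T, HasDerivAt Xφ (Xφ' t) t)
    (hXφ2 : ∀ t ∈ Set.Icc (0:ℝ) T, HasDerivAt Xφ' (Xφ'' t) t)
    (hXφc : ContinuousOn Xφ'' (Set.Icc 0 T))
    (hX0 : X 0 = x₀) (hXφ0 : Xφ 0 = x₀)
    (hX'0 : X' 0 = x₁) (hXφ'0 : Xφ' 0 = x₁)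
    (hXeq : ∀ t ∈ Set.Icc (0:ℝ) T,
      (ε^2) • X'' t = F t (X t) - lam t (X t) • X' t)
    (hXφeq : ∀ t ∈ Set.Icc (0:ℝ) T,
      (ε^2) • Xφ'' t = F t (φ t) - lam t (φ t) • Xφ' t) :
    ∀ t ∈ Set.Icc (0:ℝ) T,
      (⨆ s : Set.Icc (0:ℝ) t, ‖X s - Xφ s‖)
        ≤ (Ll * ε^2 * ‖x₁‖ / κ₀^2) * (⨆ s : Set.Icc (0:ℝ) t, ‖X s - φ s‖)
          + (LF / κ₀ + Ll * (⨆ r : Set.Icc (0:ℝ) t, ‖F r (φ r)‖) / κ₀^2)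
              * ∫ s in (0:ℝ)..t, ⨆ r : Set.Icc (0:ℝ) s, ‖X r - φ r‖ := by
  intro t ht
  obtain ⟨ht0, htT⟩ := ht
  have hsub : Set.Icc 0 t ⊆ Set.Icc 0 T := Set.Icc_subset_Icc_right htT
  have hε2 : 0 < ε ^ 2 := by positivity
  have hXcont : ContinuousOn X (Set.Icc 0 T) := fun s hs =>
    (hX1 s hs).continuousAt.continuousWithinAt
  have hX'cont : ContinuousOn X' (Set.Icc 0 T) := fun s hs =>
    (hX2 s hs).continuousAt.continuousWithinAt
  have hXφ'cont : ContinuousOn Xφ' (Set.Icc 0 T) := fun s hs =>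
    (hXφ2 s hs).continuousAt.continuousWithinAt
  have hcomp : ∀ {G : Type} [TopologicalSpace G] {H : ℝ → EuclideanSpace ℝ (Fin d) → G}
      {y : ℝ → EuclideanSpace ℝ (Fin d)},
      ContinuousOn (Function.uncurry H) (Set.Icc 0 T ×ˢ Set.univ) →
      ContinuousOn y (Set.Icc 0 T) → ContinuousOn (fun s => H s (y s)) (Set.Icc 0 T) :=
    fun hH hy => hH.comp (continuousOn_id.prodMk hy) fun s hs => ⟨hs, Set.mem_univ _⟩
  have hFφ := hcomp hFcont hφ
  have hFX := hcomp hFcont hXcont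
  have hlφ := hcomp hlamcont hφ
  have hlX := hcomp hlamcont hXcont
  set M : ℝ := ⨆ r : Set.Icc (0:ℝ) t, ‖F r (φ r)‖
  set S : ℝ → ℝ := fun s => ⨆ r : Set.Icc (0:ℝ) s, ‖X r - φ r‖
  have hdcont : ContinuousOn (fun s => ‖X s - φ s‖) (Set.Icc 0 t) :=
    ((hXcont.sub hφ).norm).mono hsub
  have hFM : ∀ r ∈ Set.Icc 0 t, ‖F r (φ r)‖ ≤ M := fun r hr =>
    (hFφ.norm.mono hsub).le_ciSup_Icc hr
  have hM0 : 0 ≤ M := (norm_nonneg _).trans (hFM 0 ⟨le_rfl, ht0⟩)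
  have hdS : ∀ r ∈ Set.Icc 0 t, ‖X r - φ r‖ ≤ S r := fun r hr =>
    (hdcont.mono (Set.Icc_subset_Icc_right hr.2)).le_ciSup_Icc ⟨hr.1, le_rfl⟩
  have hdSt : ∀ r ∈ Set.Icc 0 t, ‖X r - φ r‖ ≤ S t := fun r hr => hdcont.le_ciSup_Icc hr
  have hSt0 : 0 ≤ S t := (norm_nonneg _).trans (hdSt 0 ⟨le_rfl, ht0⟩)
  have hSint : IntervalIntegrable S volume 0 t := by
    refine MonotoneOn.intervalIntegrable ?_
    rw [Set.uIcc_of_le ht0]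
    exact hdcont.monotoneOn_ciSup_Icc
  have hX'' : ∀ s ∈ Set.Icc 0 T, X'' s = (ε ^ 2)⁻¹ • (F s (X s) - lam s (X s) • X' s) :=
    fun s hs => (eq_inv_smul_iff₀ hε2.ne').2 (hXeq s hs)
  have hXφ'' : ∀ s ∈ Set.Icc 0 T, Xφ'' s = (ε ^ 2)⁻¹ • (F s (φ s) - lam s (φ s) • Xφ' s) :=
    fun s hs => (eq_inv_smul_iff₀ hε2.ne').2 (hXφeq s hs)
  have hc : 0 < κ₀ / ε ^ 2 := by positivity
  have hW : ∀ r ∈ Set.Icc 0 t,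
      ‖Xφ' r‖ ≤ Real.exp (-(κ₀ / ε ^ 2 * r)) * ‖x₁‖ + M / κ₀ := by
    intro r hr
    have hrt : Set.Icc 0 r ⊆ Set.Icc 0 t := Set.Icc_subset_Icc_right hr.2
    have h := norm_le_exp_mul_add_of_hasDerivAt_damped (u := Xφ')
      (f := fun s => (ε ^ 2)⁻¹ • F s (φ s)) (a := fun s => lam s (φ s) / ε ^ 2)
      (M := M / ε ^ 2) hc hr.1
      (fun s hs => (hXφ2 s (hsub (hrt hs))).congr_deriv (by
        rw [hXφ'' s (hsub (hrt hs))]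
        module))
      (fun s hs => div_le_div_of_nonneg_right (hlb s (hsub (hrt hs)) _) hε2.le)
      ((hFφ.mono (hrt.trans hsub)).fun_const_smul _)
      (fun s hs => by
        rw [norm_smul, norm_inv, Real.norm_of_nonneg hε2.le, inv_mul_eq_div]
        exact div_le_div_of_nonneg_right (hFM s (hrt hs)) hε2.le)
    rwa [hXφ'0, div_div_div_cancel_right₀ hε2.ne'] at h
  have hexp : ∀ s, HasDerivAt (fun s => -(ε ^ 2 / κ₀) * Real.exp (-(κ₀ / ε ^ 2 * s)))
      (Real.exp (-(κ₀ / ε ^ 2 * s))) s := fun s => by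
    refine ((hasDerivAt_const_mul (κ₀ / ε ^ 2)).fun_neg.exp.const_mul
      (-(ε ^ 2 / κ₀))).congr_deriv ?_
    field_simp
  have hexpint : ∫ s in (0:ℝ)..t, Real.exp (-(κ₀ / ε ^ 2 * s)) ≤ ε ^ 2 / κ₀ := by
    rw [integral_eq_sub_of_hasDerivAt (fun s _ => hexp s)
      (Continuous.intervalIntegrable (by fun_prop) _ _)]
    have : 0 ≤ ε ^ 2 / κ₀ * Real.exp (-(κ₀ / ε ^ 2 * t)) := by positivity
    simp only [mul_zero, neg_zero, Real.exp_zero]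
    linarith
  set g : ℝ → EuclideanSpace ℝ (Fin d) := fun s =>
    (ε ^ 2)⁻¹ • (F s (X s) - F s (φ s) - (lam s (X s) - lam s (φ s)) • Xφ' s) with hg
  have hgcont : ContinuousOn g (Set.Icc 0 t) :=
    (((hFX.sub hFφ).sub ((hlX.sub hlφ).smul hXφ'cont)).fun_const_smul _).mono hsub
  set B : ℝ → ℝ := fun s => (LF + Ll * (M / κ₀)) * S s +
    Ll * S t * ‖x₁‖ * Real.exp (-(κ₀ / ε ^ 2 * s)) with hB
  have hgB : ∀ r ∈ Set.Icc 0 t, ‖g r‖ ≤ (ε ^ 2)⁻¹ * B r := by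
    intro r hr
    rw [hg, norm_smul, norm_inv, Real.norm_of_nonneg hε2.le]
    refine mul_le_mul_of_nonneg_left ?_ (inv_nonneg.2 hε2.le)
    have h1 := hFlip r (hsub hr) (X r) (φ r)
    have h2 := hlamlip r (hsub hr) (X r) (φ r)
    have hE := Real.exp_pos (-(κ₀ / ε ^ 2 * r))
    set D := ‖X r - φ r‖
    have hD : 0 ≤ D := norm_nonneg _
    calc _ ≤ ‖F r (X r) - F r (φ r)‖ + ‖(lam r (X r) - lam r (φ r)) • Xφ' r‖ := norm_sub_le _ _
      _ ≤ LF * D + Ll * D * (Real.exp (-(κ₀ / ε ^ 2 * r)) * ‖x₁‖ + M / κ₀) := by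
        rw [norm_smul, Real.norm_eq_abs]
        exact add_le_add h1 (mul_le_mul h2 (hW r hr) (norm_nonneg _) (by positivity))
      _ = (LF + Ll * (M / κ₀)) * D + Ll * D * ‖x₁‖ * Real.exp (-(κ₀ / ε ^ 2 * r)) := by ring
      _ ≤ B r := by
        have h3 := hdS r hr
        have h4 := hdSt r hr
        simp only [hB]
        gcongr
  have hI1 : IntervalIntegrable (fun s => (LF + Ll * (M / κ₀)) * S s) volume 0 t :=
    hSint.const_mul _
  have hI2 : IntervalIntegrable
      (fun s => Ll * S t * ‖x₁‖ * Real.exp (-(κ₀ / ε ^ 2 * s))) volume 0 t :=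
    Continuous.intervalIntegrable (by fun_prop) _ _
  have hBint : ∫ s in (0:ℝ)..t, B s ≤
      (LF + Ll * (M / κ₀)) * (∫ s in (0:ℝ)..t, S s) + Ll * S t * ‖x₁‖ * (ε ^ 2 / κ₀) := by
    rw [hB, integral_add hI1 hI2, intervalIntegral.integral_const_mul,
      intervalIntegral.integral_const_mul]
    gcongr
  have hVint : κ₀ / ε ^ 2 * ∫ s in (0:ℝ)..t, ‖X' s - Xφ' s‖ ≤
      (ε ^ 2)⁻¹ * ∫ s in (0:ℝ)..t, B s := by
    have h := norm_add_mul_integral_norm_le_of_hasDerivAt_damped (u := fun s => X' s - Xφ' s)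
      (f := g) (a := fun s => lam s (X s) / ε ^ 2) hc.le ht0
      (fun s hs => by
        refine ((hX2 s (hsub hs)).sub (hXφ2 s (hsub hs))).congr_deriv ?_
        rw [hXφ'' s (hsub hs), hX'' s (hsub hs)]
        module)
      (fun s hs => div_le_div_of_nonneg_right (hlb s (hsub hs) _) hε2.le) hgcont
    have h2 : ∫ s in (0:ℝ)..t, ‖g s‖ ≤ ∫ s in (0:ℝ)..t, (ε ^ 2)⁻¹ * B s :=
      integral_mono_on ht0 (hgcont.norm.intervalIntegrable_of_Icc ht0)
        ((hI1.add hI2).const_mul _) hgB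
    rw [intervalIntegral.integral_const_mul] at h2
    simp only [hX'0, hXφ'0, sub_self, norm_zero, zero_add] at h
    linarith [norm_nonneg (X' t - Xφ' t)]
  have hVcont : ContinuousOn (fun s => X' s - Xφ' s) (Set.Icc 0 t) :=
    (hX'cont.sub hXφ'cont).mono hsub
  have : Nonempty (Set.Icc (0:ℝ) t) := ⟨⟨0, le_rfl, ht0⟩⟩
  refine ciSup_le fun s => ?_
  obtain ⟨s, hs⟩ := s
  have hst : Set.Icc 0 s ⊆ Set.Icc 0 t := Set.Icc_subset_Icc_right hs.2
  have hZ : ‖X s - Xφ s‖ ≤ ∫ r in (0:ℝ)..t, ‖X' r - Xφ' r‖ := by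
    have h := integral_eq_sub_of_hasDerivAt (a := 0) (b := s) (f := fun r => X r - Xφ r)
      (f' := fun r => X' r - Xφ' r)
      (fun r hr => by
        rw [Set.uIcc_of_le hs.1] at hr
        exact (hX1 r (hsub (hst hr))).sub (hXφ1 r (hsub (hst hr))))
      ((hVcont.mono hst).intervalIntegrable_of_Icc hs.1)
    simp only [hX0, hXφ0, sub_self, sub_zero] at h
    rw [← h]
    refine (intervalIntegral.norm_integral_le_integral_norm hs.1).trans ?_
    exact integral_mono_interval le_rfl hs.1 hs.2
      (Filter.Eventually.of_forall fun _ => norm_nonneg _)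
      (hVcont.norm.intervalIntegrable_of_Icc ht0)
  refine hZ.trans ?_
  have h3 : κ₀ * ∫ r in (0:ℝ)..t, ‖X' r - Xφ' r‖ ≤ ∫ r in (0:ℝ)..t, B r := by
    rw [div_mul_eq_mul_div, inv_mul_eq_div] at hVint
    exact (div_le_div_iff_of_pos_right hε2).1 hVint
  refine ((le_div_iff₀' hκ).2 (h3.trans hBint)).trans_eq ?_
  field_simp
  ring
end

section
/- Let d ∈ ℕ, κ₀, L_F, L_λ > 0, T > 0, x₀ ∈ ℝ^d. Let F : [0,T] × ℝ^d → ℝ^d and λ : [0,T] × ℝ^d → ℝ be continuous with λ(t,x) ≥ κ₀, |F(t,x) − F(t,x')| ≤ L_F·|x − x'| and |λ(t,x) − λ(t,x')| ≤ L_λ·|x − x'| for all t, x, x'. Let φ : [0,T] → ℝ^d be continuous and set M_φ(t) = sup_{r ∈ [0,t]} |F(r, φ_r)|. Suppose Z and Z^φ are differentiable maps [0,T] → ℝ^d with Z(0) = Z^φ(0) = x₀, Z'(t) = F(t, Z(t)) / λ(t, Z(t)) and (Z^φ)'(t) = F(t, φ_t) / λ(t, φ_t) for all t. Then for every t ∈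 [0,T], sup_{s ∈ [0,t]} |Z^φ(s) − Z(s)| ≤ ( L_F/κ₀ + L_λ·M_φ(t)/κ₀² )·∫_0^t sup_{r ∈ [0,s]} |Z(r) − φ_r| ds. -/
open MeasureTheory intervalIntegral

/-- A continuous function is bounded above on a compact interval, phrased for suprema over
subtypes. -/
theorem bddAbove_range_Icc_of_continuousOn {g : ℝ → ℝ} {a b : ℝ}
    (hg : ContinuousOn g (Set.Icc a b)) :
    BddAbove (Set.range fun r : Set.Icc a b => g r) := by
  have h := isCompact_Icc.bddAbove_image hg
  rwa [Set.image_eq_range] at h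

theorem norm_inv_smul_sub_inv_smul_le {E : Type*} [NormedAddCommGroup E] [NormedSpace ℝ E]
    {κ a b : ℝ} (hκ : 0 < κ) (ha : κ ≤ a) (hb : κ ≤ b) (u v : E) :
    ‖a⁻¹ • u - b⁻¹ • v‖ ≤ ‖u - v‖ / κ + |a - b| * ‖u‖ / κ ^ 2 := by
  have ha0 : 0 < a := hκ.trans_le ha
  have hb0 : 0 < b := hκ.trans_le hb
  have hsplit : a⁻¹ • u - b⁻¹ • v = b⁻¹ • (u - v) + (a⁻¹ - b⁻¹) • u := by
    module
  have hinv : |a⁻¹ - b⁻¹| ≤ |a - b| / κ ^ 2 := by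
    rw [inv_sub_inv ha0.ne' hb0.ne', abs_div, abs_sub_comm b a, abs_of_pos (mul_pos ha0 hb0), sq]
    gcongr
  calc ‖a⁻¹ • u - b⁻¹ • v‖ ≤ ‖b⁻¹ • (u - v)‖ + ‖(a⁻¹ - b⁻¹) • u‖ := by
        rw [hsplit]; exact norm_add_le _ _
    _ = b⁻¹ * ‖u - v‖ + |a⁻¹ - b⁻¹| * ‖u‖ := by
        rw [norm_smul, norm_smul, Real.norm_eq_abs, Real.norm_eq_abs,
          abs_of_pos (inv_pos.mpr hb0)]
    _ ≤ κ⁻¹ * ‖u - v‖ + |a - b| / κ ^ 2 * ‖u‖ := by gcongr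
    _ = ‖u - v‖ / κ + |a - b| * ‖u‖ / κ ^ 2 := by ring

/-- A mean value inequality: if `‖f'‖ ≤ K * g` with `g` continuous and `f 0 = 0`, then
`‖f‖` is bounded by `K` times the integral of `g`. -/
theorem norm_le_mul_integral_of_norm_deriv_le {E : Type*} [NormedAddCommGroup E]
    [NormedSpace ℝ E] {f f' : ℝ → E} {g : ℝ → ℝ} {K t : ℝ}
    (hg : ContinuousOn g (Set.Icc 0 t))
    (hf : ∀ r ∈ Set.Icc 0 t, HasDerivAt f (f' r) r) (hf0 : f 0 = 0)
    (hbound : ∀ r ∈ Set.Icc 0 t, ‖f' r‖ ≤ K * g r) :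
    ∀ s ∈ Set.Icc 0 t, ‖f s‖ ≤ K * ∫ r in (0:ℝ)..s, g r := by
  intro s hs
  have ht : 0 ≤ t := hs.1.trans hs.2
  set G : ℝ → ℝ := Set.IccExtend ht ((Set.Icc 0 t).domRestrict g) with hG
  have hGc : Continuous G := hg.domRestrict.Icc_extend'
  have hGeq : ∀ r ∈ Set.Icc 0 t, G r = g r := fun r hr => by
    rw [hG, Set.IccExtend_of_mem ht _ hr]; rfl
  have hint : ∫ r in (0:ℝ)..s, g r = ∫ r in (0:ℝ)..s, G r := by
    refine intervalIntegral.integral_congr fun r hr => ?_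
    rw [Set.uIcc_of_le hs.1] at hr
    exact (hGeq r ⟨hr.1, hr.2.trans hs.2⟩).symm
  rw [hint]
  refine image_norm_le_of_norm_deriv_right_le_deriv_boundary (f := f) (f' := f')
    (B := fun s => K * ∫ r in (0:ℝ)..s, G r) (B' := fun s => K * G s)
    (fun r hr => (hf r hr).continuousAt.continuousWithinAt)
    (fun r hr => (hf r ⟨hr.1, hr.2.le⟩).hasDerivWithinAt) (by simp [hf0])
    (fun r => (hGc.integral_hasStrictDerivAt 0 r).hasDerivAt.const_mul K)
    (fun r hr => ?_) hs
  rw [hGeq r ⟨hr.1, hr.2.le⟩]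
  exact hbound r ⟨hr.1, hr.2.le⟩

/-- The integral of a continuous function is bounded by that of its running supremum. -/
theorem integral_le_integral_iSup_Icc {g : ℝ → ℝ} {t : ℝ} (ht : 0 ≤ t)
    (hg : ContinuousOn g (Set.Icc 0 t)) :
    ∫ s in (0:ℝ)..t, g s ≤ ∫ s in (0:ℝ)..t, ⨆ r : Set.Icc (0:ℝ) s, g r := by
  have hbdd : ∀ s ≤ t, BddAbove (Set.range fun r : Set.Icc (0:ℝ) s => g r) := fun s hs =>
    bddAbove_range_Icc_of_continuousOn (hg.mono (Set.Icc_subset_Icc_right hs))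
  have hmono : MonotoneOn (fun s => ⨆ r : Set.Icc (0:ℝ) s, g r) (Set.uIcc 0 t) := by
    rw [Set.uIcc_of_le ht]
    intro a ha b hb hab
    have : Nonempty (Set.Icc (0:ℝ) a) := ⟨⟨0, le_rfl, ha.1⟩⟩
    exact ciSup_le fun r => le_ciSup (hbdd b hb.2) ⟨r, r.2.1, r.2.2.trans hab⟩
  refine intervalIntegral.integral_mono_on ht (hg.intervalIntegrable_of_Icc ht)
    hmono.intervalIntegrable fun s hs => ?_
  exact le_ciSup (hbdd s hs.2) ⟨s, hs.1, le_rfl⟩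

/-- estimate (5.10) of the paper: comparison of the solution
of the fully coupled first-order equation `Z' = F(t,Z)/λ(t,Z)` with the
solution of the first-order equation with coefficients frozen along `φ`. -/
theorem stmt10 (d : ℕ) (κ₀ LF Ll T : ℝ) (hκ : 0 < κ₀)
    (hLF : 0 < LF) (hLl : 0 < Ll) (hT : 0 < T)
    (x₀ : EuclideanSpace ℝ (Fin d))
    (F : ℝ → EuclideanSpace ℝ (Fin d) → EuclideanSpace ℝ (Fin d))
    (lam : ℝ → EuclideanSpace ℝ (Fin d) → ℝ)
    (hFcont : ContinuousOn (Function.uncurry F) (Set.Icc 0 T ×ˢ Set.univ))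
    (hlamcont : ContinuousOn (Function.uncurry lam) (Set.Icc 0 T ×ˢ Set.univ))
    (hlb : ∀ t ∈ Set.Icc (0:ℝ) T, ∀ x : EuclideanSpace ℝ (Fin d), κ₀ ≤ lam t x)
    (hFlip : ∀ t ∈ Set.Icc (0:ℝ) T, ∀ x x' : EuclideanSpace ℝ (Fin d),
      ‖F t x - F t x'‖ ≤ LF * ‖x - x'‖)
    (hlamlip : ∀ t ∈ Set.Icc (0:ℝ) T, ∀ x x' : EuclideanSpace ℝ (Fin d),
      |lam t x - lam t x'| ≤ Ll * ‖x - x'‖)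
    (φ : ℝ → EuclideanSpace ℝ (Fin d)) (hφ : ContinuousOn φ (Set.Icc 0 T))
    (Z Z' Zφ Zφ' : ℝ → EuclideanSpace ℝ (Fin d))
    (hZ : ∀ t ∈ Set.Icc (0:ℝ) T, HasDerivAt Z (Z' t) t)
    (hZφ : ∀ t ∈ Set.Icc (0:ℝ) T, HasDerivAt Zφ (Zφ' t) t)
    (hZ0 : Z 0 = x₀) (hZφ0 : Zφ 0 = x₀)
    (hZeq : ∀ t ∈ Set.Icc (0:ℝ) T, Z' t = (lam t (Z t))⁻¹ • F t (Z t))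
    (hZφeq : ∀ t ∈ Set.Icc (0:ℝ) T, Zφ' t = (lam t (φ t))⁻¹ • F t (φ t)) :
    ∀ t ∈ Set.Icc (0:ℝ) T,
      (⨆ s : Set.Icc (0:ℝ) t, ‖Zφ s - Z s‖)
        ≤ (LF / κ₀ + Ll * (⨆ r : Set.Icc (0:ℝ) t, ‖F r (φ r)‖) / κ₀^2)
            * ∫ s in (0:ℝ)..t, ⨆ r : Set.Icc (0:ℝ) s, ‖Z r - φ r‖ := by
  intro t ht
  have hsub : Set.Icc 0 t ⊆ Set.Icc 0 T := Set.Icc_subset_Icc_right ht.2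
  set M := ⨆ r : Set.Icc (0:ℝ) t, ‖F r (φ r)‖
  set K := LF / κ₀ + Ll * M / κ₀ ^ 2 with hK
  have hM0 : 0 ≤ M := Real.iSup_nonneg fun _ => norm_nonneg _
  have hK0 : 0 ≤ K := by positivity
  have hFφ : ContinuousOn (fun r => ‖F r (φ r)‖) (Set.Icc 0 t) :=
    ((hFcont.comp (continuousOn_id.prodMk hφ) fun r hr => ⟨hr, Set.mem_univ _⟩).norm).mono hsub
  have hM : ∀ r ∈ Set.Icc 0 t, ‖F r (φ r)‖ ≤ M := fun r hr =>
    le_ciSup (bddAbove_range_Icc_of_continuousOn hFφ) ⟨r, hr⟩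
  have hg : ContinuousOn (fun r => ‖Z r - φ r‖) (Set.Icc 0 t) :=
    fun r hr => ((hZ r (hsub hr)).continuousAt.continuousWithinAt.sub
      (hφ.mono hsub r hr)).norm
  have hderiv : ∀ r ∈ Set.Icc 0 t, ‖Zφ' r - Z' r‖ ≤ K * ‖Z r - φ r‖ := by
    intro r hr
    have hrT := hsub hr
    rw [hZeq r hrT, hZφeq r hrT]
    refine (norm_inv_smul_sub_inv_smul_le hκ (hlb r hrT _) (hlb r hrT _) _ _).trans ?_
    have h1 := hFlip r hrT (φ r) (Z r)
    have h2 := hlamlip r hrT (φ r) (Z r)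
    have h3 := hM r hr
    rw [norm_sub_rev (φ r)] at h1 h2
    calc _ ≤ LF * ‖Z r - φ r‖ / κ₀ + Ll * ‖Z r - φ r‖ * M / κ₀ ^ 2 := by gcongr
      _ = K * ‖Z r - φ r‖ := by rw [hK]; ring
  have hmain := norm_le_mul_integral_of_norm_deriv_le hg
    (f := fun r => Zφ r - Z r) (fun r hr => (hZφ r (hsub hr)).sub (hZ r (hsub hr)))
    (by simp [hZ0, hZφ0]) hderiv
  have : Nonempty (Set.Icc (0:ℝ) t) := ⟨⟨0, le_rfl, ht.1⟩⟩
  refine ciSup_le fun s => (hmain s s.2).trans (mul_le_mul_of_nonneg_left ?_ hK0)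
  refine le_trans ?_ (integral_le_integral_iSup_Icc ht.1 hg)
  exact intervalIntegral.integral_mono_interval le_rfl s.2.1 s.2.2
    (Filter.Eventually.of_forall fun r => norm_nonneg _) (hg.intervalIntegrable_of_Icc ht.1)
end

section
/- Let d, l ∈ ℕ, κ₀, L, C̃, K, Λ₁ > 0. Let F : [0,1] × ℝ^d × ℝ^l → ℝ^d and λ : [0,1] × ℝ^d × ℝ^l → ℝ be measurable with λ(t,x,y) ≥ κ₀, |F(t,x,y) − F(t,x',y)| ≤ L·|x − x'|, |λ(t,x,y) − λ(t,x',y)| ≤ L·|x − x'|, and |F(t,x,y)| + |λ(t,x,y)| ≤ C̃·(1 + t + |x|) for all t, x, x', y. Let ξ : [0,1] → ℝ^l be measurable, and let φ : [0,1] → ℝ^d be continuous such that t ↦ F(t, φ_t, ξ_t) is continuous and t ↦ λ(t, φ_t, ξ_t) is continuously differentiable with derivative bounded in absolute value by Λ₁. Then there exist ε₀ > 0 and constants C₁, C₂, C ≥ 0, depending only on κ₀, L, C̃, K, Λ₁ and sup_{t ∈ [0,1]} |φ_t|, such that for every ε ∈ (0, ε₀], every x₀ ∈ ℝ^d, every x₁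 ∈ ℝ^d with ε·|x₁| ≤ K, every twice continuously differentiable X : [0,1] → ℝ^d with X(0) = x₀, X'(0) = x₁ and ε²·X''(t) = F(t, X(t), ξ_t) − λ(t, X(t), ξ_t)·X'(t) for all t, and every differentiable Z : [0,1] → ℝ^d with Z(0) = x₀ and Z'(t) = F(t, Z(t), ξ_t) / λ(t, Z(t), ξ_t) for all t, one has sup_{t ∈ [0,1]} |X(t) − φ_t| ≤ C₁·ε + C·sup_{t ∈ [0,1]} |Z(t) − φ_t| and sup_{t ∈ [0,1]} |Z(t) − φ_t| ≤ C₂·ε + C·sup_{t ∈ [0,1]} |X(t) − φ_t|. -/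
open MeasureTheory intervalIntegral

theorem add_div_le_exp_mul_of_hasDerivAt_le {y y' : ℝ → ℝ} {a b : ℝ} (ha : a ≠ 0)
    (hy : ∀ t ∈ Set.Icc (0:ℝ) 1, HasDerivAt y (y' t) t)
    (hle : ∀ t ∈ Set.Icc (0:ℝ) 1, y' t ≤ a * y t + b) {t : ℝ} (ht : t ∈ Set.Icc (0:ℝ) 1) :
    y t + b / a ≤ Real.exp (a * t) * (y 0 + b / a) := by
  have hd : ∀ s ∈ Set.Icc (0:ℝ) 1, HasDerivAt (fun s => Real.exp (-(a * s)) * (y s + b / a))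
      (Real.exp (-(a * s)) * (y' s - (a * y s + b))) s := by
    intro s hs
    have h1 : HasDerivAt (fun s => Real.exp (-(a * s))) (Real.exp (-(a * s)) * (-(a * 1))) s :=
      (((hasDerivAt_id' s).const_mul a).neg).exp
    refine (h1.mul ((hy s hs).add_const (b / a))).congr_deriv ?_
    field_simp
    ring
  have hanti : AntitoneOn (fun s => Real.exp (-(a * s)) * (y s + b / a)) (Set.Icc 0 1) := by
    refine antitoneOn_of_deriv_nonpos (convex_Icc 0 1)
      (fun s hs => (hd s hs).continuousAt.continuousWithinAt)
      (fun s hs => (hd s (interior_subset hs)).differentiableAt.differentiableWithinAt) ?_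
    intro s hs
    rw [(hd s (interior_subset hs)).deriv]
    exact mul_nonpos_of_nonneg_of_nonpos (Real.exp_pos _).le
      (sub_nonpos.2 (hle s (interior_subset hs)))
  have h := hanti (Set.left_mem_Icc.2 zero_le_one) ht ht.1
  simp only [mul_zero, neg_zero, Real.exp_zero, one_mul] at h
  calc y t + b / a = Real.exp (a * t) * (Real.exp (-(a * t)) * (y t + b / a)) := by
        rw [← mul_assoc, ← Real.exp_add]; simp
    _ ≤ _ := by gcongr

section RegularizedNorm

variable {E : Type*} [NormedAddCommGroup E]

/-- A smooth approximation of the norm from above. -/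
noncomputable def regNorm (η : ℝ) (v : E) : ℝ := √(η ^ 2 + ‖v‖ ^ 2)

theorem norm_le_regNorm (η : ℝ) (v : E) : ‖v‖ ≤ regNorm η v :=
  Real.le_sqrt_of_sq_le (by nlinarith [sq_nonneg η])

theorem le_regNorm (η : ℝ) (v : E) : η ≤ regNorm η v :=
  Real.le_sqrt_of_sq_le (by nlinarith [sq_nonneg ‖v‖])

theorem regNorm_le {η : ℝ} (hη : 0 ≤ η) (v : E) : regNorm η v ≤ η + ‖v‖ :=
  Real.sqrt_le_iff.2 ⟨by positivity, by nlinarith [mul_nonneg hη (norm_nonneg v)]⟩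

theorem regNorm_pos {η : ℝ} (hη : 0 < η) (v : E) : 0 < regNorm η v :=
  hη.trans_le (le_regNorm η v)

theorem regNorm_sq (η : ℝ) (v : E) : regNorm η v ^ 2 = η ^ 2 + ‖v‖ ^ 2 :=
  Real.sq_sqrt (by positivity)

variable [InnerProductSpace ℝ E]

theorem hasDerivAt_regNorm {η : ℝ} (hη : 0 < η) {v : ℝ → E} {v' : E} {t : ℝ}
    (hv : HasDerivAt v v' t) :
    HasDerivAt (fun s => regNorm η (v s)) (inner ℝ (v t) v' / regNorm η (v t)) t := by
  refine ((hv.norm_sq.const_add (η ^ 2)).sqrt (by positivity)).congr_deriv ?_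
  exact mul_div_mul_left _ _ two_ne_zero

theorem inner_div_regNorm_le {η : ℝ} (hη : 0 < η) (v w : E) :
    inner ℝ v w / regNorm η v ≤ ‖w‖ := by
  rw [div_le_iff₀ (regNorm_pos hη v), mul_comm]
  exact (real_inner_le_norm v w).trans (by gcongr; exact norm_le_regNorm η v)

/-- Damping estimate: the friction term `a • v` contracts the regularized norm of `v`. -/
theorem mul_inner_div_regNorm_le {η κ a c : ℝ} (hη : 0 < η) (hκ : 0 ≤ κ) (ha : κ ≤ a)
    {v w f : E} (hw : c • w = f - a • v) :
    c * (inner ℝ v w / regNorm η v) ≤ ‖f‖ - κ * (regNorm η v - η) := by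
  have hs := regNorm_pos hη v
  have h1 : c * inner ℝ v w = inner ℝ v f - a * ‖v‖ ^ 2 := by
    rw [← real_inner_smul_right, hw, inner_sub_right, real_inner_smul_right,
      real_inner_self_eq_norm_sq]
  have h2 : inner ℝ v f ≤ regNorm η v * ‖f‖ :=
    (real_inner_le_norm v f).trans (by gcongr; exact norm_le_regNorm η v)
  have h3 : κ * ‖v‖ ^ 2 ≤ a * ‖v‖ ^ 2 := by gcongr
  have h4 : regNorm η v * (regNorm η v - η) ≤ ‖v‖ ^ 2 := by
    nlinarith [regNorm_sq η v, le_regNorm η v]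
  rw [← mul_div_assoc, div_le_iff₀ hs, h1]
  nlinarith [mul_le_mul_of_nonneg_left h4 hκ]

end RegularizedNorm

section Comparison

variable {E : Type*} [NormedAddCommGroup E] [InnerProductSpace ℝ E]

theorem norm_first_order_le {A : ℝ} (hA : 0 < A) {Z Z' : ℝ → E}
    (hZ : ∀ t ∈ Set.Icc (0:ℝ) 1, HasDerivAt Z (Z' t) t)
    (hZ' : ∀ t ∈ Set.Icc (0:ℝ) 1, ‖Z' t‖ ≤ A * (2 + ‖Z t‖))
    {t : ℝ} (ht : t ∈ Set.Icc (0:ℝ) 1) :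
    ‖Z t‖ ≤ Real.exp A * 3 * (1 + ‖Z 0‖) := by
  have h := add_div_le_exp_mul_of_hasDerivAt_le (b := 2 * A) hA.ne'
    (fun s hs => hasDerivAt_regNorm one_pos (hZ s hs))
    (fun s hs => (inner_div_regNorm_le one_pos _ _).trans ((hZ' s hs).trans (by
      nlinarith [norm_le_regNorm 1 (Z s)]))) ht
  rw [mul_div_assoc, div_self hA.ne', mul_one] at h
  calc ‖Z t‖ ≤ regNorm 1 (Z t) + 2 := by linarith [norm_le_regNorm 1 (Z t)]
    _ ≤ _ := h
    _ ≤ Real.exp A * (1 + ‖Z 0‖ + 2) := by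
      have := regNorm_le zero_le_one (Z 0)
      have := (regNorm_pos one_pos (Z 0)).le
      gcongr
      nlinarith [ht.2]
    _ ≤ _ := by
      rw [mul_assoc]
      gcongr
      linarith [norm_nonneg (Z 0)]

theorem norm_second_order_le {κ c K ε : ℝ} (hκ : 0 < κ) (hc : 0 < c)
    (hε : 0 < ε) (hε1 : ε ≤ 1) {X X' X'' f : ℝ → E} {a : ℝ → ℝ}
    (hX : ∀ t ∈ Set.Icc (0:ℝ) 1, HasDerivAt X (X' t) t)
    (hX' : ∀ t ∈ Set.Icc (0:ℝ) 1, HasDerivAt X' (X'' t) t)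
    (hode : ∀ t ∈ Set.Icc (0:ℝ) 1, (ε ^ 2) • X'' t = f t - a t • X' t)
    (ha : ∀ t ∈ Set.Icc (0:ℝ) 1, κ ≤ a t)
    (hf : ∀ t ∈ Set.Icc (0:ℝ) 1, ‖f t‖ ≤ c * (2 + ‖X t‖))
    (h0 : ε * ‖X' 0‖ ≤ K) {t : ℝ} (ht : t ∈ Set.Icc (0:ℝ) 1) :
    ‖X t‖ ≤ Real.exp (c / κ) * (3 + (K + 1) / κ + κ / c) * (1 + ‖X 0‖) := by
  have hA : 0 < c / κ := by positivity
  have hK : 0 ≤ K := le_trans (by positivity) h0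
  have h := add_div_le_exp_mul_of_hasDerivAt_le (b := 2 * (c / κ) + 1) hA.ne'
    (fun s hs => (hasDerivAt_regNorm one_pos (hX s hs)).add
      ((hasDerivAt_regNorm one_pos (hX' s hs)).const_mul (ε ^ 2 / κ))) (by
      intro s hs
      have h1 := inner_div_regNorm_le one_pos (X s) (X' s)
      have h2 := mul_inner_div_regNorm_le one_pos hκ.le (ha s hs) (hode s hs)
      have h3 := norm_le_regNorm 1 (X' s)
      have h4 := norm_le_regNorm 1 (X s)
      have h5 : ε ^ 2 / κ * (inner ℝ (X' s) (X'' s) / regNorm 1 (X' s)) ≤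
          c / κ * (2 + ‖X s‖) - (regNorm 1 (X' s) - 1) := by
        calc _ = (ε ^ 2 * (inner ℝ (X' s) (X'' s) / regNorm 1 (X' s))) / κ := by ring
          _ ≤ (c * (2 + ‖X s‖) - κ * (regNorm 1 (X' s) - 1)) / κ := by
            gcongr; linarith [hf s hs]
          _ = _ := by field_simp
      have h6 : 0 ≤ ε ^ 2 / κ * regNorm 1 (X' s) := by
        have := (regNorm_pos one_pos (X' s)).le
        positivity
      simp only [Pi.add_apply]
      nlinarith [mul_le_mul_of_nonneg_left h4 hA.le, mul_nonneg hA.le h6]) ht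
  simp only [Pi.add_apply] at h
  have hp : (2 * (c / κ) + 1) / (c / κ) = 2 + κ / c := by field_simp
  rw [hp] at h
  have p1 := (regNorm_pos one_pos (X 0)).le
  have p2 := (regNorm_pos one_pos (X' 0)).le
  have p3 := (regNorm_pos one_pos (X' t)).le
  have h7 : ε ^ 2 / κ * regNorm 1 (X' 0) ≤ (K + 1) / κ := by
    rw [div_mul_eq_mul_div]
    gcongr
    nlinarith [regNorm_le zero_le_one (X' 0), sq_nonneg ε, mul_nonneg hε.le (norm_nonneg (X' 0))]
  calc ‖X t‖ ≤ regNorm 1 (X t) + ε ^ 2 / κ * regNorm 1 (X' t) + (2 + κ / c) := by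
        have : 0 ≤ ε ^ 2 / κ * regNorm 1 (X' t) := by positivity
        have : 0 ≤ κ / c := by positivity
        linarith [norm_le_regNorm 1 (X t)]
    _ ≤ _ := h
    _ ≤ Real.exp (c / κ) * (1 + ‖X 0‖ + (K + 1) / κ + (2 + κ / c)) := by
      have := regNorm_le zero_le_one (X 0)
      gcongr
      nlinarith [ht.2]
    _ ≤ _ := by
      rw [mul_assoc]
      gcongr
      have : 0 ≤ (K + 1) / κ := by positivity
      have : 0 ≤ κ / c := by positivity
      nlinarith [norm_nonneg (X 0)]

theorem norm_velocity_le {κ m ε : ℝ} (hκ : 0 < κ) (hε : 0 < ε) {X' X'' f : ℝ → E} {a : ℝ → ℝ}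
    (hX' : ∀ t ∈ Set.Icc (0:ℝ) 1, HasDerivAt X' (X'' t) t)
    (hode : ∀ t ∈ Set.Icc (0:ℝ) 1, (ε ^ 2) • X'' t = f t - a t • X' t)
    (ha : ∀ t ∈ Set.Icc (0:ℝ) 1, κ ≤ a t)
    (hf : ∀ t ∈ Set.Icc (0:ℝ) 1, ‖f t‖ ≤ m) {t : ℝ} (ht : t ∈ Set.Icc (0:ℝ) 1) :
    ‖X' t‖ ≤ (‖X' 0‖ + 1) * Real.exp (-(κ / ε ^ 2) * t) + (m / κ + 1) := by
  have hk : 0 < κ / ε ^ 2 := by positivity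
  have hm : 0 ≤ m := (norm_nonneg _).trans (hf t ht)
  have h := add_div_le_exp_mul_of_hasDerivAt_le (a := -(κ / ε ^ 2)) (b := (m + κ) / ε ^ 2)
    (neg_ne_zero.2 hk.ne') (fun s hs => hasDerivAt_regNorm one_pos (hX' s hs)) (by
      intro s hs
      have h2 := mul_inner_div_regNorm_le one_pos hκ.le (ha s hs) (hode s hs)
      have h3 := hf s hs
      calc inner ℝ (X' s) (X'' s) / regNorm 1 (X' s)
          = (ε ^ 2 * (inner ℝ (X' s) (X'' s) / regNorm 1 (X' s))) / ε ^ 2 := by field_simp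
        _ ≤ (m - κ * (regNorm 1 (X' s) - 1)) / ε ^ 2 := by gcongr; linarith
        _ = _ := by ring) ht
  have hq : (m + κ) / ε ^ 2 / -(κ / ε ^ 2) = -(m / κ + 1) := by field_simp
  rw [hq] at h
  have he := Real.exp_pos (-(κ / ε ^ 2) * t)
  have : 0 ≤ m / κ := by positivity
  nlinarith [regNorm_le zero_le_one (X' 0), norm_le_regNorm 1 (X' t)]

set_option maxHeartbeats 1000000 in
theorem exists_norm_sub_le {κ L K Λ m n r : ℝ} (hκ : 0 < κ) (hL : 0 < L) (hK : 0 ≤ K)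
    (hΛ : 0 ≤ Λ) (hm : 0 ≤ m) (hn : 0 ≤ n) (hr : 0 ≤ r) :
    ∃ P, 0 ≤ P ∧ ∀ (ε δ : ℝ) (X X' X'' Z Z' φ fX fZ : ℝ → E) (aX aZ g g' : ℝ → ℝ),
      0 < ε → ε ≤ 1 → 0 ≤ δ → ε * ‖X' 0‖ ≤ K → X 0 = Z 0 →
      (∀ t ∈ Set.Icc (0:ℝ) 1,
        HasDerivAt X (X' t) t ∧ HasDerivAt X' (X'' t) t ∧ HasDerivAt Z (Z' t) t ∧
        HasDerivAt g (g' t) t) →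
      (∀ t ∈ Set.Icc (0:ℝ) 1, (ε ^ 2) • X'' t = fX t - aX t • X' t) →
      (∀ t ∈ Set.Icc (0:ℝ) 1, Z' t = (aZ t)⁻¹ • fZ t) →
      (∀ t ∈ Set.Icc (0:ℝ) 1, κ ≤ g t ∧ κ ≤ aZ t ∧ |g' t| ≤ Λ) →
      (∀ t ∈ Set.Icc (0:ℝ) 1, ‖fX t - fZ t‖ ≤ L * ‖X t - Z t‖) →
      (∀ t ∈ Set.Icc (0:ℝ) 1, |aX t - g t| ≤ L * ‖X t - φ t‖) →
      (∀ t ∈ Set.Icc (0:ℝ) 1, |aZ t - g t| ≤ L * ‖Z t - φ t‖) →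
      (∀ t ∈ Set.Icc (0:ℝ) 1, ‖fZ t‖ ≤ m) →
      (∀ t ∈ Set.Icc (0:ℝ) 1,
        ‖X' t‖ ≤ (‖X' 0‖ + 1) * Real.exp (-(κ / ε ^ 2) * t) + n) →
      (∀ t ∈ Set.Icc (0:ℝ) 1, ‖X t - φ t‖ ≤ r) →
      (∀ t ∈ Set.Icc (0:ℝ) 1, ‖X t - φ t‖ ≤ ‖X t - Z t‖ + δ) →
      (∀ t ∈ Set.Icc (0:ℝ) 1, ‖Z t - φ t‖ ≤ ‖X t - Z t‖ + δ) →
      ∀ t ∈ Set.Icc (0:ℝ) 1, ‖X t - Z t‖ ≤ P * (ε + δ) := by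
  obtain ⟨A, hA⟩ : ∃ A : ℝ, A = L / κ + m * L / κ ^ 2 + L * n / κ := ⟨_, rfl⟩
  have hA0 : 0 < A := by rw [hA]; positivity
  obtain ⟨k₁, hk₁⟩ : ∃ k₁ : ℝ, k₁ = K + 1 + n := ⟨_, rfl⟩
  have hk₁0 : 0 ≤ k₁ := by rw [hk₁]; positivity
  obtain ⟨S, hS⟩ : ∃ S : ℝ,
      S = 2 + K / κ + L * r * (K + 1) / κ ^ 2 + k₁ / κ + Λ * k₁ / κ ^ 2 / A := ⟨_, rfl⟩
  have hS0 : 0 ≤ S := by rw [hS]; positivity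
  refine ⟨Real.exp A * S + k₁ / κ, by positivity, ?_⟩
  intro ε δ X X' X'' Z Z' φ fX fZ aX aZ g g' hε hε1 hδ hx1 h0 hd hX'' hZ' hg hfL haX haZ hfZ hv
    hXr hXφ hZφ t ht
  have hεε : ε ^ 2 ≤ ε := by nlinarith
  have hgpos : ∀ s ∈ Set.Icc (0:ℝ) 1, 0 < g s := fun s hs => hκ.trans_le (hg s hs).1
  have hvel : ∀ s ∈ Set.Icc (0:ℝ) 1, ε ^ 2 * ‖X' s‖ ≤ ε * k₁ := by
    intro s hs
    have h1 : Real.exp (-(κ / ε ^ 2) * s) ≤ 1 := by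
      have : 0 ≤ κ / ε ^ 2 * s := mul_nonneg (by positivity) hs.1
      exact Real.exp_le_one_iff.2 (by linarith)
    have h2 : ‖X' s‖ ≤ (‖X' 0‖ + 1) * 1 + n := (hv s hs).trans (by gcongr)
    have h3 : ε * ‖X' s‖ ≤ k₁ := by nlinarith
    nlinarith
  set W : ℝ → E := fun s => X s - Z s + (ε ^ 2 * (g s)⁻¹) • X' s with hW
  set W' : ℝ → E := fun s => X' s - Z' s + ((ε ^ 2 * (g s)⁻¹) • X'' s +
    (ε ^ 2 * (-g' s / g s ^ 2)) • X' s) with hWd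
  have hWderiv : ∀ s ∈ Set.Icc (0:ℝ) 1, HasDerivAt W (W' s) s := by
    intro s hs
    obtain ⟨h1, h2, h3, h4⟩ := hd s hs
    exact (h1.sub h3).add (((h4.inv (hgpos s hs).ne').const_mul (ε ^ 2)).smul h2)
  have hcorr : ∀ s ∈ Set.Icc (0:ℝ) 1, ‖(ε ^ 2 * (g s)⁻¹) • X' s‖ ≤ ε * k₁ / κ := by
    intro s hs
    have := hgpos s hs
    rw [norm_smul, Real.norm_of_nonneg (by positivity)]
    calc ε ^ 2 * (g s)⁻¹ * ‖X' s‖ = ε ^ 2 * ‖X' s‖ / g s := by ring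
      _ ≤ ε * k₁ / κ := div_le_div₀ (by positivity) (hvel s hs) hκ (hg s hs).1
  have hXZ : ∀ s ∈ Set.Icc (0:ℝ) 1, ‖X s - Z s‖ ≤ ‖W s‖ + ε * k₁ / κ := by
    intro s hs
    have : X s - Z s = W s - (ε ^ 2 * (g s)⁻¹) • X' s := by simp [hW]
    rw [this]
    exact (norm_sub_le _ _).trans (by gcongr; exact hcorr s hs)
  have hWdec : ∀ s ∈ Set.Icc (0:ℝ) 1, W' s = (g s)⁻¹ • (fX s - fZ s) +
      ((aZ s - g s) / (g s * aZ s)) • fZ s + ((g s - aX s) / g s) • X' s +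
      (ε ^ 2 * (-g' s / g s ^ 2)) • X' s := by
    intro s hs
    have h1 : (ε ^ 2 * (g s)⁻¹) • X'' s = (g s)⁻¹ • (fX s - aX s • X' s) := by
      rw [← hX'' s hs, smul_smul, mul_comm]
    have h2 := (hgpos s hs).ne'
    have h3 : aZ s ≠ 0 := (hκ.trans_le (hg s hs).2.1).ne'
    simp only [hWd]
    rw [h1, hZ' s hs]
    match_scalars <;> field_simp <;> ring
  obtain ⟨Q, hQ⟩ : ∃ Q : ℝ, Q = L * r / κ * (‖X' 0‖ + 1) := ⟨_, rfl⟩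
  have hQ0 : 0 ≤ Q := by rw [hQ]; positivity
  have hWle : ∀ s ∈ Set.Icc (0:ℝ) 1, ‖W' s‖ ≤ A * ‖W s‖ +
      (A * δ + ε * (A * k₁ / κ + Λ * k₁ / κ ^ 2)) + Q * Real.exp (-(κ / ε ^ 2) * s) := by
    intro s hs
    have hgs := hgpos s hs
    obtain ⟨hg1, hg2, hg3⟩ := hg s hs
    have haZs : 0 < aZ s := hκ.trans_le hg2
    have t1 : ‖(g s)⁻¹ • (fX s - fZ s)‖ ≤ L / κ * ‖X s - Z s‖ := by
      rw [norm_smul, Real.norm_of_nonneg (by positivity)]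
      calc (g s)⁻¹ * ‖fX s - fZ s‖ ≤ κ⁻¹ * (L * ‖X s - Z s‖) := by
            gcongr; exact hfL s hs
        _ = _ := by ring
    have t2 : ‖((aZ s - g s) / (g s * aZ s)) • fZ s‖ ≤ m * L / κ ^ 2 * (‖X s - Z s‖ + δ) := by
      rw [norm_smul, Real.norm_eq_abs, abs_div, abs_of_pos (mul_pos hgs haZs)]
      calc |aZ s - g s| / (g s * aZ s) * ‖fZ s‖ ≤ L * (‖X s - Z s‖ + δ) / (κ * κ) * m := by
            gcongr
            · exact (haZ s hs).trans (by gcongr; exact hZφ s hs)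
            · exact hfZ s hs
        _ = _ := by ring
    have t3 : ‖((g s - aX s) / g s) • X' s‖ ≤ L * n / κ * (‖X s - Z s‖ + δ) +
        Q * Real.exp (-(κ / ε ^ 2) * s) := by
      rw [norm_smul, Real.norm_eq_abs, abs_div, abs_of_pos hgs, abs_sub_comm]
      calc |aX s - g s| / g s * ‖X' s‖
          ≤ L * ‖X s - φ s‖ / κ * ((‖X' 0‖ + 1) * Real.exp (-(κ / ε ^ 2) * s) + n) := by
            gcongr
            · exact haX s hs
            · exact hv s hs
        _ = L * n / κ * ‖X s - φ s‖ +
            L * ‖X s - φ s‖ / κ * (‖X' 0‖ + 1) * Real.exp (-(κ / ε ^ 2) * s) := by ring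
        _ ≤ _ := by
            rw [hQ]
            gcongr
            · exact hXφ s hs
            · exact hXr s hs
    have t4 : ‖(ε ^ 2 * (-g' s / g s ^ 2)) • X' s‖ ≤ ε * (Λ * k₁ / κ ^ 2) := by
      rw [norm_smul, Real.norm_eq_abs, abs_mul, abs_div, abs_neg, abs_of_pos (pow_pos hgs 2),
        abs_of_pos (pow_pos hε 2)]
      calc ε ^ 2 * (|g' s| / g s ^ 2) * ‖X' s‖ = |g' s| / g s ^ 2 * (ε ^ 2 * ‖X' s‖) := by ring
        _ ≤ Λ / κ ^ 2 * (ε * k₁) := by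
            exact mul_le_mul (by gcongr) (hvel s hs) (by positivity) (by positivity)
        _ = _ := by ring
    rw [hWdec s hs]
    have h1 : ‖X s - Z s‖ + δ ≤ ‖W s‖ + ε * k₁ / κ + δ := by linarith [hXZ s hs]
    have h2 : L / κ * ‖X s - Z s‖ ≤ L / κ * (‖X s - Z s‖ + δ) := by gcongr; linarith
    calc _ ≤ L / κ * (‖X s - Z s‖ + δ) + m * L / κ ^ 2 * (‖X s - Z s‖ + δ) +
          (L * n / κ * (‖X s - Z s‖ + δ) + Q * Real.exp (-(κ / ε ^ 2) * s)) +
          ε * (Λ * k₁ / κ ^ 2) :=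
          (norm_add₄_le).trans (by linarith)
      _ = A * (‖X s - Z s‖ + δ) + Q * Real.exp (-(κ / ε ^ 2) * s) +
          ε * (Λ * k₁ / κ ^ 2) := by rw [hA]; ring
      _ ≤ A * (‖W s‖ + ε * k₁ / κ + δ) + Q * Real.exp (-(κ / ε ^ 2) * s) +
          ε * (Λ * k₁ / κ ^ 2) := by gcongr
      _ = _ := by ring
  have hexp : ∀ s : ℝ, HasDerivAt (fun s => Q * ε ^ 2 / κ * Real.exp (-(κ / ε ^ 2) * s))
      (-(Q * Real.exp (-(κ / ε ^ 2) * s))) s := by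
    intro s
    refine ((((hasDerivAt_id' s).const_mul (-(κ / ε ^ 2))).exp).const_mul
      (Q * ε ^ 2 / κ)).congr_deriv ?_
    field_simp
  have h := add_div_le_exp_mul_of_hasDerivAt_le
    (b := A * δ + ε * (A * k₁ / κ + Λ * k₁ / κ ^ 2)) hA0.ne'
    (fun s hs => (hasDerivAt_regNorm hε (hWderiv s hs)).add (hexp s)) (by
      intro s hs
      simp only [Pi.add_apply]
      have h1 := (inner_div_regNorm_le hε (W s) (W' s)).trans (hWle s hs)
      have h2 : 0 ≤ Q * ε ^ 2 / κ * Real.exp (-(κ / ε ^ 2) * s) := by positivity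
      nlinarith [mul_le_mul_of_nonneg_left (norm_le_regNorm ε (W s)) hA0.le,
        mul_nonneg hA0.le h2]) ht
  simp only [Pi.add_apply, mul_zero, Real.exp_zero, mul_one] at h
  have hb : (A * δ + ε * (A * k₁ / κ + Λ * k₁ / κ ^ 2)) / A =
      δ + ε * (k₁ / κ + Λ * k₁ / κ ^ 2 / A) := by field_simp
  rw [hb] at h
  have hW0 : ‖W 0‖ ≤ ε * (K / κ) := by
    have hg0 := hg 0 (by simp)
    have hgp := hgpos 0 (by simp)
    have : W 0 = (ε ^ 2 * (g 0)⁻¹) • X' 0 := by simp [hW, h0]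
    rw [this, norm_smul, Real.norm_of_nonneg (by positivity)]
    calc ε ^ 2 * (g 0)⁻¹ * ‖X' 0‖ = ε * (ε * ‖X' 0‖ / g 0) := by ring
      _ ≤ _ := by gcongr; exact hg0.1
  have hQε : Q * ε ^ 2 / κ ≤ ε * (L * r * (K + 1) / κ ^ 2) := by
    calc Q * ε ^ 2 / κ = L * r / κ ^ 2 * (ε * (ε * ‖X' 0‖ + ε)) := by rw [hQ]; ring
      _ ≤ L * r / κ ^ 2 * (ε * (K + 1)) := by gcongr
      _ = _ := by ring
  have hreg0 := regNorm_le hε.le (W 0)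
  have hstart : regNorm ε (W 0) + Q * ε ^ 2 / κ + (δ + ε * (k₁ / κ + Λ * k₁ / κ ^ 2 / A)) ≤
      S * (ε + δ) := by
    have h1 : regNorm ε (W 0) + Q * ε ^ 2 / κ + (δ + ε * (k₁ / κ + Λ * k₁ / κ ^ 2 / A)) ≤
        (S - 1) * ε + δ := by rw [hS]; linarith
    have h2 : 1 ≤ S := by
      have : 0 ≤ K / κ + L * r * (K + 1) / κ ^ 2 + k₁ / κ + Λ * k₁ / κ ^ 2 / A := by positivity
      rw [hS]; linarith
    nlinarith [mul_nonneg (sub_nonneg.2 h2) hδ]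
  have hend : ‖W t‖ ≤ Real.exp A * (S * (ε + δ)) := by
    have h1 : 0 ≤ Q * ε ^ 2 / κ * Real.exp (-(κ / ε ^ 2) * t) := by positivity
    have h2 : 0 ≤ δ + ε * (k₁ / κ + Λ * k₁ / κ ^ 2 / A) := by positivity
    have h3 : 0 ≤ regNorm ε (W 0) + Q * ε ^ 2 / κ +
        (δ + ε * (k₁ / κ + Λ * k₁ / κ ^ 2 / A)) := by
      have := (regNorm_pos hε (W 0)).le
      positivity
    calc ‖W t‖ ≤ _ := by linarith [norm_le_regNorm ε (W t)]
      _ ≤ _ := h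
      _ ≤ _ := by
        gcongr
        nlinarith [ht.2]
  calc ‖X t - Z t‖ ≤ Real.exp A * (S * (ε + δ)) + ε * k₁ / κ := by linarith [hXZ t ht]
    _ ≤ _ := by
      have : 0 ≤ k₁ / κ * δ := by positivity
      have h3 : ε * k₁ / κ = k₁ / κ * ε := by ring
      rw [h3]; linarith

end Comparison

theorem norm_sub_le_iSup_Icc {E : Type*} [NormedAddCommGroup E] {u v : ℝ → E}
    (hu : ContinuousOn u (Set.Icc 0 1)) (hv : ContinuousOn v (Set.Icc 0 1)) :
    ∀ t ∈ Set.Icc (0:ℝ) 1, ‖u t - v t‖ ≤ ⨆ s : Set.Icc (0:ℝ) 1, ‖u s - v s‖ := by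
  intro t ht
  have hb : BddAbove (Set.range fun s : Set.Icc (0:ℝ) 1 => ‖u s - v s‖) := by
    have := isCompact_Icc.bddAbove_image (hu.sub hv).norm
    rwa [Set.image_eq_range] at this
  exact le_ciSup hb ⟨t, ht⟩

/-- the two-sided pathwise comparison (5.13)–(5.14) of the
paper: under Assumption 2.4 (uniform Lipschitz continuity, lower bound `κ₀`
for `λ`, and linear growth) and the condition `ε‖x₁‖ ≤ K`, the second-order
solution `X` and the first-order solution `Z` are sup-norm close to a reference
path `φ` up to constants depending only on `κ₀, L, C̃, K, Λ₁` and (a bound `R`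
for) `sup_{t∈[0,1]} ‖φ_t‖`. -/
theorem stmt11 (d l : ℕ) (κ₀ L Ctil K Λ₁ R : ℝ)
    (hκ : 0 < κ₀) (hL : 0 < L) (hC : 0 < Ctil) (hK : 0 < K) (hΛ : 0 < Λ₁)
    (hR : 0 ≤ R) :
    ∃ ε₀ > (0:ℝ), ∃ C₁ C₂ C : ℝ, 0 ≤ C₁ ∧ 0 ≤ C₂ ∧ 0 ≤ C ∧
      ∀ (F : ℝ → EuclideanSpace ℝ (Fin d) → EuclideanSpace ℝ (Fin l) →
            EuclideanSpace ℝ (Fin d))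
        (lam : ℝ → EuclideanSpace ℝ (Fin d) → EuclideanSpace ℝ (Fin l) → ℝ)
        (ξ : ℝ → EuclideanSpace ℝ (Fin l))
        (φ : ℝ → EuclideanSpace ℝ (Fin d)) (lamφ' : ℝ → ℝ),
        Measurable (fun p : ℝ × EuclideanSpace ℝ (Fin d) ×
            EuclideanSpace ℝ (Fin l) => F p.1 p.2.1 p.2.2) →
        Measurable (fun p : ℝ × EuclideanSpace ℝ (Fin d) ×
            EuclideanSpace ℝ (Fin l) => lam p.1 p.2.1 p.2.2) →
        Measurable ξ →
        (∀ t ∈ Set.Icc (0:ℝ) 1, ∀ (x : EuclideanSpace ℝ (Fin d))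
          (y : EuclideanSpace ℝ (Fin l)), κ₀ ≤ lam t x y) →
        (∀ t ∈ Set.Icc (0:ℝ) 1, ∀ (x x' : EuclideanSpace ℝ (Fin d))
          (y : EuclideanSpace ℝ (Fin l)),
            ‖F t x y - F t x' y‖ ≤ L * ‖x - x'‖) →
        (∀ t ∈ Set.Icc (0:ℝ) 1, ∀ (x x' : EuclideanSpace ℝ (Fin d))
          (y : EuclideanSpace ℝ (Fin l)),
            |lam t x y - lam t x' y| ≤ L * ‖x - x'‖) →
        (∀ t ∈ Set.Icc (0:ℝ) 1, ∀ (x : EuclideanSpace ℝ (Fin d))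
          (y : EuclideanSpace ℝ (Fin l)),
            ‖F t x y‖ + |lam t x y| ≤ Ctil * (1 + t + ‖x‖)) →
        ContinuousOn φ (Set.Icc 0 1) →
        (∀ t ∈ Set.Icc (0:ℝ) 1, ‖φ t‖ ≤ R) →
        ContinuousOn (fun t => F t (φ t) (ξ t)) (Set.Icc 0 1) →
        (∀ t ∈ Set.Icc (0:ℝ) 1,
          HasDerivAt (fun t => lam t (φ t) (ξ t)) (lamφ' t) t) →
        ContinuousOn lamφ' (Set.Icc 0 1) →
        (∀ t ∈ Set.Icc (0:ℝ) 1, |lamφ' t| ≤ Λ₁) →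
        ∀ ε : ℝ, 0 < ε → ε ≤ ε₀ →
        ∀ x₀ x₁ : EuclideanSpace ℝ (Fin d), ε * ‖x₁‖ ≤ K →
        ∀ X X' X'' : ℝ → EuclideanSpace ℝ (Fin d),
          (∀ t ∈ Set.Icc (0:ℝ) 1, HasDerivAt X (X' t) t) →
          (∀ t ∈ Set.Icc (0:ℝ) 1, HasDerivAt X' (X'' t) t) →
          ContinuousOn X'' (Set.Icc 0 1) →
          X 0 = x₀ → X' 0 = x₁ →
          (∀ t ∈ Set.Icc (0:ℝ) 1,
            (ε^2) • X'' t = F t (X t) (ξ t) - lam t (X t) (ξ t) • X' t) →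
        ∀ Z Z' : ℝ → EuclideanSpace ℝ (Fin d),
          (∀ t ∈ Set.Icc (0:ℝ) 1, HasDerivAt Z (Z' t) t) →
          Z 0 = x₀ →
          (∀ t ∈ Set.Icc (0:ℝ) 1,
            Z' t = (lam t (Z t) (ξ t))⁻¹ • F t (Z t) (ξ t)) →
          (⨆ t : Set.Icc (0:ℝ) 1, ‖X t - φ t‖)
              ≤ C₁ * ε + C * ⨆ t : Set.Icc (0:ℝ) 1, ‖Z t - φ t‖
            ∧ (⨆ t : Set.Icc (0:ℝ) 1, ‖Z t - φ t‖)
              ≤ C₂ * ε + C * ⨆ t : Set.Icc (0:ℝ) 1, ‖X t - φ t‖ := by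
  obtain ⟨G, hG⟩ : ∃ G : ℝ, G = Real.exp (Ctil / κ₀) * (3 + (K + 1) / κ₀ + κ₀ / Ctil) :=
    ⟨_, rfl⟩
  have hG0 : 0 ≤ G := by rw [hG]; positivity
  have hGZ : Real.exp (Ctil / κ₀) * 3 ≤ G := by
    have : 0 ≤ (K + 1) / κ₀ + κ₀ / Ctil := by positivity
    rw [hG]
    gcongr
    linarith
  obtain ⟨m, hm⟩ : ∃ m : ℝ, m = Ctil * (2 + G * (2 + R)) := ⟨_, rfl⟩
  have hm0 : 0 ≤ m := by rw [hm]; positivity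
  obtain ⟨P, hP, hmain⟩ := exists_norm_sub_le (E := EuclideanSpace ℝ (Fin d)) (κ := κ₀) (L := L)
    (K := K) (Λ := Λ₁) (m := m) (n := m / κ₀ + 1) (r := G * (2 + R) + R) hκ hL hK.le hΛ.le hm0
    (by positivity) (by positivity)
  refine ⟨1, one_pos, P, P, P + 1 + (G * (2 + R) + R), hP, hP, by positivity, ?_⟩
  intro F lam ξ φ lamφ' _ _ _ hlam hFL hlamL hgrow hφ hφR _ hlamφ _ hΛb ε hε hε1 x₀ x₁ hx1
    X X' X'' hX hX' _ hX0 hX'0 hode Z Z' hZ hZ0 hZ'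
  subst hX'0
  have hF : ∀ t ∈ Set.Icc (0:ℝ) 1, ∀ x y, ‖F t x y‖ ≤ Ctil * (2 + ‖x‖) := by
    intro t ht x y
    have h1 : Ctil * (1 + t + ‖x‖) ≤ Ctil * (2 + ‖x‖) := by
      gcongr
      linarith [ht.2]
    linarith [hgrow t ht x y, abs_nonneg (lam t x y)]
  have hXG : ∀ t ∈ Set.Icc (0:ℝ) 1, ‖X t‖ ≤ G * (1 + ‖x₀‖) := by
    intro t ht
    rw [hG, ← hX0]
    exact norm_second_order_le hκ hC hε hε1 hX hX' hode (fun s hs => hlam s hs _ _)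
      (fun s hs => hF s hs _ _) hx1 ht
  have hZG : ∀ t ∈ Set.Icc (0:ℝ) 1, ‖Z t‖ ≤ G * (1 + ‖x₀‖) := by
    intro t ht
    rw [← hZ0]
    refine (norm_first_order_le (A := Ctil / κ₀) (by positivity) hZ ?_ ht).trans (by gcongr)
    intro s hs
    have h1 := hlam s hs (Z s) (ξ s)
    have h2 : 0 < lam s (Z s) (ξ s) := hκ.trans_le h1
    rw [hZ' s hs, norm_smul, Real.norm_of_nonneg (by positivity)]
    calc (lam s (Z s) (ξ s))⁻¹ * ‖F s (Z s) (ξ s)‖ ≤ κ₀⁻¹ * (Ctil * (2 + ‖Z s‖)) := by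
          gcongr
          exact hF s hs _ _
      _ = _ := by ring
  have hXb := norm_sub_le_iSup_Icc (fun t ht => (hX t ht).continuousAt.continuousWithinAt) hφ
  have hZb := norm_sub_le_iSup_Icc (fun t ht => (hZ t ht).continuousAt.continuousWithinAt) hφ
  set δX := ⨆ t : Set.Icc (0:ℝ) 1, ‖X t - φ t‖
  set δZ := ⨆ t : Set.Icc (0:ℝ) 1, ‖Z t - φ t‖
  have h01 : (0:ℝ) ∈ Set.Icc (0:ℝ) 1 := by simp
  have hδX : 0 ≤ δX := (norm_nonneg _).trans (hXb 0 h01)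
  have hδZ : 0 ≤ δZ := (norm_nonneg _).trans (hZb 0 h01)
  suffices h : ∀ t ∈ Set.Icc (0:ℝ) 1,
      ‖X t - φ t‖ ≤ P * ε + (P + 1 + (G * (2 + R) + R)) * δZ ∧
      ‖Z t - φ t‖ ≤ P * ε + (P + 1 + (G * (2 + R) + R)) * δX from
    ⟨ciSup_le fun t => (h t t.2).1, ciSup_le fun t => (h t t.2).2⟩
  intro t ht
  have hGR : 0 ≤ G * (2 + R) + R := by positivity
  have hPε : 0 ≤ P * ε := by positivity
  rcases le_or_gt ‖x₀‖ (R + 1) with hx | hx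
  · have hb : G * (1 + ‖x₀‖) ≤ G * (2 + R) :=
      mul_le_mul_of_nonneg_left (by linarith) hG0
    have hFm : ∀ s ∈ Set.Icc (0:ℝ) 1, ∀ x y, ‖x‖ ≤ G * (1 + ‖x₀‖) → ‖F s x y‖ ≤ m := by
      intro s hs x y hxs
      refine (hF s hs x y).trans ?_
      rw [hm]
      gcongr
      exact hxs.trans hb
    have htri : ∀ s, ‖X s - φ s‖ ≤ ‖X s - Z s‖ + ‖Z s - φ s‖ := fun s =>
      norm_sub_le_norm_sub_add_norm_sub _ _ _
    have htri' : ∀ s, ‖Z s - φ s‖ ≤ ‖X s - Z s‖ + ‖X s - φ s‖ := fun s => by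
      rw [norm_sub_rev (X s) (Z s)]
      exact norm_sub_le_norm_sub_add_norm_sub _ _ _
    have key : ∀ δ, 0 ≤ δ → (∀ s ∈ Set.Icc (0:ℝ) 1, ‖X s - φ s‖ ≤ ‖X s - Z s‖ + δ) →
        (∀ s ∈ Set.Icc (0:ℝ) 1, ‖Z s - φ s‖ ≤ ‖X s - Z s‖ + δ) →
        ‖X t - Z t‖ ≤ P * (ε + δ) := fun δ hδ h1 h2 =>
      hmain ε δ X X' X'' Z Z' φ (fun s => F s (X s) (ξ s)) (fun s => F s (Z s) (ξ s))
        (fun s => lam s (X s) (ξ s)) (fun s => lam s (Z s) (ξ s))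
        (fun s => lam s (φ s) (ξ s)) lamφ' hε hε1 hδ hx1 (hX0.trans hZ0.symm)
        (fun s hs => ⟨hX s hs, hX' s hs, hZ s hs, hlamφ s hs⟩) hode hZ'
        (fun s hs => ⟨hlam s hs _ _, hlam s hs _ _, hΛb s hs⟩)
        (fun s hs => hFL s hs _ _ _) (fun s hs => hlamL s hs _ _ _)
        (fun s hs => hlamL s hs _ _ _) (fun s hs => hFm s hs _ _ (hZG s hs))
        (fun s hs => norm_velocity_le hκ hε hX' hode (fun u hu => hlam u hu _ _)
          (fun u hu => hFm u hu _ _ (hXG u hu)) hs)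
        (fun s hs => (norm_sub_le _ _).trans
          (add_le_add ((hXG s hs).trans hb) (hφR s hs))) h1 h2 t ht
    have kZ := key δZ hδZ (fun s hs => (htri s).trans (by gcongr; exact hZb s hs))
      (fun s hs => (hZb s hs).trans (by linarith [norm_nonneg (X s - Z s)]))
    have kX := key δX hδX (fun s hs => (hXb s hs).trans (by linarith [norm_nonneg (X s - Z s)]))
      (fun s hs => (htri' s).trans (by gcongr; exact hXb s hs))
    constructor
    · linarith [htri t, hZb t ht, mul_nonneg hGR hδZ]
    · linarith [htri' t, hXb t ht, mul_nonneg hGR hδX]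
  · have hlarge : ∀ (v : EuclideanSpace ℝ (Fin d)) (δ : ℝ), ‖v‖ ≤ G * (1 + ‖x₀‖) →
        ‖x₀ - φ 0‖ ≤ δ → ‖v - φ t‖ ≤ P * ε + (P + 1 + (G * (2 + R) + R)) * δ := by
      intro v δ hv hδ
      have h1 : ‖x₀‖ - R ≤ δ := by linarith [norm_sub_norm_le x₀ (φ 0), hφR 0 h01]
      have h2 : 1 ≤ δ := by linarith
      have h3 : 1 + ‖x₀‖ ≤ (2 + R) * δ := by nlinarith
      have h4 : G * (1 + ‖x₀‖) ≤ G * ((2 + R) * δ) := by gcongr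
      have h5 : R ≤ R * δ := le_mul_of_one_le_right hR h2
      have h6 : 0 ≤ (P + 1) * δ := by positivity
      linarith [norm_sub_le v (φ t), hφR t ht]
    exact ⟨hlarge _ _ (hXG t ht) (hZ0 ▸ hZb 0 h01), hlarge _ _ (hZG t ht) (hX0 ▸ hXb 0 h01)⟩
end

section
/- For each ε ∈ (0,1], let X^ε and Z^ε be Borel-measurable random elements of a metric space (S,d), defined on a common probability space with probability measure P_ε. Suppose that for every φ ∈ S there exist constants a_φ, b_φ, ε_φ > 0 such that for all ε ∈ (0, ε_φ], almost surely d(X^ε, φ) ≤ a_φ·ε + b_φ·d(Z^ε, φ) and d(Z^ε, φ) ≤ a_φ·ε + b_φ·d(X^ε, φ). If the family (Z^ε)_{ε ∈ (0,1]} satisfies the local large deviations principle with local rate function J : S → [0,∞], then the family (X^ε)_{ε ∈ (0,1]} satisfies the local large deviations principle with the same local rate function J. -/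
open MeasureTheory Filter

/-- The family of laws of the random elements `X ε` under `P ε` satisfies the
local large deviations principle with local rate function `J : S → [0,∞]`:
for every `φ`, the limits as `δ → 0⁺` of the `limsup` and `liminf` as
`ε → 0⁺` of `ε · log P_ε(d(X^ε, φ) < δ)` both equal `−J(φ)` (in `EReal`). -/
def LocalLDPfam {S : Type*} [PseudoMetricSpace S] {Ω : Type*} [MeasurableSpace Ω]
    (P : ℝ → Measure Ω) (X : ℝ → Ω → S) (J : S → ENNReal) : Prop :=
  ∀ φ : S,
    Tendsto (fun δ : ℝ =>
        limsup (fun ε : ℝ =>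
            (ε : EReal) * ENNReal.log (P ε {ω | dist (X ε ω) φ < δ}))
          (nhdsWithin 0 (Set.Ioi 0)))
      (nhdsWithin 0 (Set.Ioi 0)) (nhds (-(J φ : EReal)))
    ∧
    Tendsto (fun δ : ℝ =>
        liminf (fun ε : ℝ =>
            (ε : EReal) * ENNReal.log (P ε {ω | dist (X ε ω) φ < δ}))
          (nhdsWithin 0 (Set.Ioi 0)))
      (nhdsWithin 0 (Set.Ioi 0)) (nhds (-(J φ : EReal)))

/-- If `d(V^ε, φ) ≤ a ε + b d(U^ε, φ)` almost surely for small `ε`, then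
the scaled log-probability that `U^ε` lies in the ball of radius `δ / (2 b)` is eventually at most
the one that `V^ε` lies in the ball of radius `δ`. -/
theorem eventually_mul_log_ball_le {S : Type*} [PseudoMetricSpace S] {Ω : Type*}
    [MeasurableSpace Ω] {P : ℝ → Measure Ω} {U V : ℝ → Ω → S} {φ : S} {a b : ℝ} (hb : 0 < b)
    (h : ∀ᶠ ε in nhdsWithin (0 : ℝ) (Set.Ioi 0),
      ∀ᵐ ω ∂(P ε), dist (V ε ω) φ ≤ a * ε + b * dist (U ε ω) φ)
    {δ : ℝ} (hδ : 0 < δ) :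
    ∀ᶠ ε : ℝ in nhdsWithin 0 (Set.Ioi 0),
      (ε : EReal) * ENNReal.log (P ε {ω | dist (U ε ω) φ < δ / (2 * b)}) ≤
        (ε : EReal) * ENNReal.log (P ε {ω | dist (V ε ω) φ < δ}) := by
  have hsmall : ∀ᶠ ε : ℝ in nhdsWithin 0 (Set.Ioi 0), a * ε < δ / 2 := by
    have hcont : Tendsto (fun ε : ℝ => a * ε) (nhdsWithin 0 (Set.Ioi 0)) (nhds (a * 0)) :=
      ((continuous_const_mul a).tendsto 0).mono_left nhdsWithin_le_nhds
    exact hcont.eventually_lt_const (by simpa using hδ)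
  filter_upwards [h, hsmall, self_mem_nhdsWithin] with ε hε haε hpos
  refine mul_le_mul_of_nonneg_left (ENNReal.log_monotone (measure_mono_ae ?_))
    (EReal.coe_nonneg.2 (le_of_lt hpos))
  filter_upwards [hε] with ω hω hU
  have hbU : b * dist (U ε ω) φ < δ / 2 := by
    calc b * dist (U ε ω) φ < b * (δ / (2 * b)) := mul_lt_mul_of_pos_left hU hb
      _ = δ / 2 := by field_simp
  change dist (V ε ω) φ < δ
  linarith

theorem tendsto_mul_const_nhdsGT_zero {c : ℝ} (hc : 0 < c) :
    Tendsto (fun δ : ℝ => δ * c) (nhdsWithin 0 (Set.Ioi 0)) (nhdsWithin 0 (Set.Ioi 0)) := by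
  refine tendsto_nhdsWithin_iff.2 ⟨?_, ?_⟩
  · simpa using ((continuous_mul_const c).tendsto 0).mono_left nhdsWithin_le_nhds
  · filter_upwards [self_mem_nhdsWithin] with δ hδ using mul_pos hδ hc

/-- transfer of the local large deviations principle from the
first-order solutions `Z^ε` to the second-order solutions `X^ε` via a two-sided
pathwise comparison `d(X^ε,φ) ≤ a_φ ε + b_φ d(Z^ε,φ)` and vice versa. -/
theorem stmt12 {S : Type*} [MetricSpace S] [MeasurableSpace S] [BorelSpace S]
    {Ω : Type*} [MeasurableSpace Ω]
    (P : ℝ → Measure Ω) (hP : ∀ ε ∈ Set.Ioc (0:ℝ) 1, IsProbabilityMeasure (P ε))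
    (X Z : ℝ → Ω → S)
    (hXmeas : ∀ ε ∈ Set.Ioc (0:ℝ) 1, Measurable (X ε))
    (hZmeas : ∀ ε ∈ Set.Ioc (0:ℝ) 1, Measurable (Z ε))
    (hcomp : ∀ φ : S, ∃ a b εφ : ℝ, 0 < a ∧ 0 < b ∧ 0 < εφ ∧
      ∀ ε ∈ Set.Ioc (0:ℝ) εφ,
        ∀ᵐ ω ∂(P ε),
          dist (X ε ω) φ ≤ a * ε + b * dist (Z ε ω) φ ∧
          dist (Z ε ω) φ ≤ a * ε + b * dist (X ε ω) φ)
    (J : S → ENNReal) (hZ : LocalLDPfam P Z J) :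
    LocalLDPfam P X J := by
  intro φ
  obtain ⟨a, b, εφ, -, hb, hεφ, h⟩ := hcomp φ
  have hev : ∀ᶠ ε in nhdsWithin (0 : ℝ) (Set.Ioi 0), ε ∈ Set.Ioc (0 : ℝ) εφ :=
    Ioc_mem_nhdsGT hεφ
  have hXZ : ∀ᶠ ε in nhdsWithin (0 : ℝ) (Set.Ioi 0),
      ∀ᵐ ω ∂(P ε), dist (X ε ω) φ ≤ a * ε + b * dist (Z ε ω) φ :=
    hev.mono fun ε hε => (h ε hε).mono fun _ hω => hω.1
  have hZX : ∀ᶠ ε in nhdsWithin (0 : ℝ) (Set.Ioi 0),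
      ∀ᵐ ω ∂(P ε), dist (Z ε ω) φ ≤ a * ε + b * dist (X ε ω) φ :=
    hev.mono fun ε hε => (h ε hε).mono fun _ hω => hω.2
  have hb2 : 0 < 2 * b := by positivity
  have hdown := tendsto_mul_const_nhdsGT_zero (inv_pos.2 hb2)
  have hup := tendsto_mul_const_nhdsGT_zero hb2
  have hlower := fun {δ : ℝ} (hδ : 0 < δ) => eventually_mul_log_ball_le hb hXZ hδ
  have hupper := fun {δ : ℝ} (hδ : 0 < δ) =>
    eventually_mul_log_ball_le hb hZX (mul_pos hδ hb2)
  simp only [mul_div_cancel_right₀ _ hb2.ne'] at hupper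
  simp only [div_eq_mul_inv _ (2 * b)] at hlower
  obtain ⟨hsup, hinf⟩ := hZ φ
  constructor
  · refine tendsto_of_tendsto_of_tendsto_of_le_of_le' (hsup.comp hdown) (hsup.comp hup) ?_ ?_
    · filter_upwards [self_mem_nhdsWithin] with δ hδ using limsup_le_limsup (hlower hδ)
    · filter_upwards [self_mem_nhdsWithin] with δ hδ using limsup_le_limsup (hupper hδ)
  · refine tendsto_of_tendsto_of_tendsto_of_le_of_le' (hinf.comp hdown) (hinf.comp hup) ?_ ?_
    · filter_upwards [self_mem_nhdsWithin] with δ hδ using liminf_le_liminf (hlower hδ)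
    · filter_upwards [self_mem_nhdsWithin] with δ hδ using liminf_le_liminf (hupper hδ)
end

section
/- Let S be a complete separable metric space and let (P_ε)_{ε ∈ (0,1]} be a family of Borel probability measures on S that is exponentially tight. Then the family is sequentially large-deviations relatively compact: for every sequence ε_k → 0 there exist a subsequence (ε_{k_j}) and a function I : S → [0,∞] with compact sublevel sets {z : I(z) ≤ L} for every L > 0, such that liminf_{j→∞} ε_{k_j}·log P_{ε_{k_j}}(G) ≥ −inf_{z ∈ G} I(z) for every open set G ⊆ S and limsup_{j→∞} ε_{k_j}·log P_{ε_{k_j}}(F) ≤ −inf_{z ∈ F} I(z) for every closed set F ⊆ S. -/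
open MeasureTheory Filter

/-- The family `(P ε)` of Borel probability measures on `S` is exponentially
tight: there is an increasing sequence of compact sets `K L` with
`lim_{L→∞} limsup_{ε→0⁺} ε · log P_ε((K L)ᶜ) = −∞`. -/
def ExpTightFam {S : Type*} [TopologicalSpace S] [MeasurableSpace S]
    (P : ℝ → Measure S) : Prop :=
  ∃ K : ℕ → Set S, (∀ L : ℕ, IsCompact (K L)) ∧ Monotone K ∧
    Tendsto (fun L : ℕ =>
        limsup (fun ε : ℝ => (ε : EReal) * ENNReal.log (P ε (K L)ᶜ))
          (nhdsWithin 0 (Set.Ioi 0)))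
      atTop (nhds (⊥ : EReal))

open Topology TopologicalSpace

lemma EReal.le_neg_coe_ennreal_of_forall_lt {a : EReal} {M : ENNReal} (ha : a ≤ 0)
    (h : ∀ c < M, a ≤ -(c : EReal)) : a ≤ -(M : EReal) := by
  have h0 : 0 ≤ -a := by simpa using EReal.neg_le_neg_iff.2 ha
  have hM : M ≤ (-a).toENNReal := le_of_forall_lt_imp_le_of_dense fun c hc => by
    simpa using EReal.toENNReal_le_toENNReal (EReal.le_neg_of_le_neg (h c hc))
  have := EReal.coe_ennreal_le_coe_ennreal_iff.2 hM
  rw [EReal.coe_toENNReal h0] at this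
  exact EReal.le_neg_of_le_neg this

section BasisRate

variable {S : Type*} [TopologicalSpace S] [SecondCountableTopology S]

/-- The rate function determined by the logarithmic masses `ℓ` of basic open sets. -/
noncomputable def basisRate (ℓ : countableBasis S → EReal) (x : S) : ENNReal :=
  ⨆ (U : countableBasis S) (_ : x ∈ U.1), (-ℓ U).toENNReal

variable {ℓ : countableBasis S → EReal}

lemma neg_basisRate_le {U : countableBasis S} {x : S} (hx : x ∈ U.1) :
    -(basisRate ℓ x : EReal) ≤ ℓ U := by
  have h : (-ℓ U).toENNReal ≤ basisRate ℓ x :=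
    le_iSup₂ (f := fun (U : countableBasis S) (_ : x ∈ U.1) => (-ℓ U).toENNReal) U hx
  have h' := EReal.coe_ennreal_le_coe_ennreal_iff.2 h
  rw [EReal.coe_toENNReal_eq_max] at h'
  exact EReal.neg_le_of_neg_le ((le_max_right _ _).trans h')

lemma exists_lt_toENNReal_of_lt_basisRate {c : ENNReal} {x : S} (h : c < basisRate ℓ x) :
    ∃ U : countableBasis S, x ∈ U.1 ∧ c < (-ℓ U).toENNReal := by
  simpa [basisRate, lt_iSup_iff] using h

lemma lowerSemicontinuous_basisRate : LowerSemicontinuous (basisRate ℓ) := by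
  intro x c hc
  obtain ⟨U, hxU, hU⟩ := exists_lt_toENNReal_of_lt_basisRate hc
  filter_upwards [(isOpen_of_mem_countableBasis U.2).mem_nhds hxU] with y hy
  exact hU.trans_le
    (le_iSup₂ (f := fun (U : countableBasis S) (_ : y ∈ U.1) => (-ℓ U).toENNReal) U hy)

end BasisRate

section LargeDeviations

variable {S : Type*} [MeasurableSpace S]

/-- The logarithmic mass `ε j * log (μ j A)` of a set along a sequence of measures. -/
noncomputable def scaledLog (ε : ℕ → ℝ) (μ : ℕ → Measure S) (A : Set S) (j : ℕ) : EReal :=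
  (ε j : EReal) * ENNReal.log (μ j A)

variable {ε : ℕ → ℝ} {μ : ℕ → Measure S}

lemma scaledLog_mono (hε : ∀ j, 0 < ε j) {A B : Set S} (h : A ⊆ B) :
    scaledLog ε μ A ≤ scaledLog ε μ B := fun j =>
  mul_le_mul_of_nonneg_left (ENNReal.log_le_log (measure_mono h))
    (EReal.coe_nonneg.2 (hε j).le)

lemma scaledLog_nonpos (hε : ∀ j, 0 < ε j) (hμ : ∀ j, IsProbabilityMeasure (μ j)) (A : Set S) :
    scaledLog ε μ A ≤ 0 := fun j => by
  have := hμ j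
  simpa [scaledLog] using mul_le_mul_of_nonneg_left
    (ENNReal.log_le_zero_iff.2 (prob_le_one (μ := μ j) (s := A)))
    (EReal.coe_nonneg.2 (hε j).le)

lemma limsup_scaledLog_mono (hε : ∀ j, 0 < ε j) {A B : Set S} (h : A ⊆ B) :
    limsup (scaledLog ε μ A) atTop ≤ limsup (scaledLog ε μ B) atTop :=
  limsup_le_limsup (Eventually.of_forall (scaledLog_mono hε h))

lemma limsup_scaledLog_empty (hε : ∀ j, 0 < ε j) :
    limsup (scaledLog ε μ ∅) atTop = ⊥ := by
  have : scaledLog ε μ ∅ = fun _ => ⊥ := by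
    funext j
    simp [scaledLog, EReal.coe_mul_bot_of_pos (hε j)]
  rw [this, limsup_const]

lemma limsup_scaledLog_union (hε : ∀ j, 0 < ε j) (hε0 : Tendsto ε atTop (𝓝 0)) (A B : Set S) :
    limsup (scaledLog ε μ (A ∪ B)) atTop
      ≤ max (limsup (scaledLog ε μ A) atTop) (limsup (scaledLog ε μ B) atTop) := by
  have h2 : ENNReal.log 2 = (Real.log 2 : ℝ) := by
    simpa using ENNReal.log_ofReal_of_pos (x := 2) two_pos
  have hlog : limsup (fun j => ((ε j * Real.log 2 : ℝ) : EReal)) atTop = 0 := by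
    apply Tendsto.limsup_eq
    simpa [Function.comp_def] using
      (continuous_coe_real_ereal.tendsto _).comp (hε0.mul_const (Real.log 2))
  have key : scaledLog ε μ (A ∪ B) ≤ (fun j => ((ε j * Real.log 2 : ℝ) : EReal)) +
      fun j => max (scaledLog ε μ A j) (scaledLog ε μ B j) := fun j => by
    have hnn : (0 : EReal) ≤ ε j := EReal.coe_nonneg.2 (hε j).le
    have hmass : μ j (A ∪ B) ≤ 2 * max (μ j A) (μ j B) := by
      refine (measure_union_le A B).trans ?_
      rw [two_mul]
      exact add_le_add (le_max_left _ _) (le_max_right _ _)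
    refine (mul_le_mul_of_nonneg_left (ENNReal.log_le_log hmass) hnn).trans ?_
    rw [ENNReal.log_mul_add, EReal.left_distrib_of_nonneg_of_ne_top hnn (EReal.coe_ne_top _), h2,
      ENNReal.log_monotone.map_max, (monotone_mul_left_of_nonneg hnn).map_max, ← EReal.coe_mul]
    exact le_rfl
  refine (limsup_le_limsup (Eventually.of_forall key)).trans ?_
  refine (EReal.limsup_add_le (.inl (by rw [hlog]; exact EReal.zero_ne_bot))
    (.inl (by rw [hlog]; exact EReal.zero_ne_top))).trans ?_
  rw [hlog, zero_add, limsup_max]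

variable [TopologicalSpace S] [SecondCountableTopology S] {ℓ : countableBasis S → EReal}

lemma neg_iInf_basisRate_le_liminf (hε : ∀ j, 0 < ε j)
    (hℓ : ∀ U : countableBasis S, Tendsto (scaledLog ε μ U) atTop (𝓝 (ℓ U)))
    {G : Set S} (hG : IsOpen G) :
    -((⨅ z ∈ G, basisRate ℓ z : ENNReal) : EReal) ≤ liminf (scaledLog ε μ G) atTop := by
  have hpt : ∀ x ∈ G, -(basisRate ℓ x : EReal) ≤ liminf (scaledLog ε μ G) atTop := by
    intro x hx
    obtain ⟨U, hU, hxU, hUG⟩ :=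
      (isBasis_countableBasis S).exists_subset_of_mem_open hx hG
    refine (neg_basisRate_le (U := ⟨U, hU⟩) hxU).trans ?_
    rw [← (hℓ ⟨U, hU⟩).liminf_eq]
    exact liminf_le_liminf (Eventually.of_forall (scaledLog_mono hε hUG))
  refine EReal.neg_le_of_neg_le ?_
  have hle : (-liminf (scaledLog ε μ G) atTop).toENNReal ≤ ⨅ z ∈ G, basisRate ℓ z :=
    le_iInf₂ fun x hx => by
      simpa using EReal.toENNReal_le_toENNReal (EReal.neg_le_of_neg_le (hpt x hx))
  have h' := EReal.coe_ennreal_le_coe_ennreal_iff.2 hle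
  rw [EReal.coe_toENNReal_eq_max] at h'
  exact (le_max_right _ _).trans h'

lemma limsup_le_neg_iInf_basisRate_of_isCompact (hε : ∀ j, 0 < ε j)
    (hε0 : Tendsto ε atTop (𝓝 0)) (hμ : ∀ j, IsProbabilityMeasure (μ j))
    (hℓ : ∀ U : countableBasis S, Tendsto (scaledLog ε μ U) atTop (𝓝 (ℓ U)))
    {K : Set S} (hK : IsCompact K) :
    limsup (scaledLog ε μ K) atTop ≤ -((⨅ z ∈ K, basisRate ℓ z : ENNReal) : EReal) := by
  refine EReal.le_neg_coe_ennreal_of_forall_lt ?_ fun c hc => ?_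
  · exact (limsup_le_limsup (Eventually.of_forall (scaledLog_nonpos hε hμ K))).trans_eq
      (limsup_const 0)
  refine hK.induction_on (p := fun A => limsup (scaledLog ε μ A) atTop ≤ -(c : EReal))
    (by simp [limsup_scaledLog_empty hε])
    (fun A B hAB hB => (limsup_scaledLog_mono hε hAB).trans hB)
    (fun A B hA hB => (limsup_scaledLog_union hε hε0 A B).trans (max_le hA hB)) fun x hx => ?_
  obtain ⟨U, hxU, hU⟩ := exists_lt_toENNReal_of_lt_basisRate (hc.trans_le (iInf₂_le x hx))
  refine ⟨U, mem_nhdsWithin_of_mem_nhds ((isOpen_of_mem_countableBasis U.2).mem_nhds hxU), ?_⟩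
  rw [(hℓ U).limsup_eq]
  have h' := EReal.coe_ennreal_lt_coe_ennreal_iff.2 hU
  rw [EReal.coe_toENNReal (EReal.toENNReal_pos_iff.1 (bot_le.trans_lt hU)).le] at h'
  exact EReal.le_neg_of_le_neg h'.le

lemma limsup_le_neg_iInf_basisRate (hε : ∀ j, 0 < ε j)
    (hε0 : Tendsto ε atTop (𝓝 0)) (hμ : ∀ j, IsProbabilityMeasure (μ j))
    (hℓ : ∀ U : countableBasis S, Tendsto (scaledLog ε μ U) atTop (𝓝 (ℓ U)))
    {K : ℕ → Set S} (hK : ∀ L, IsCompact (K L))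
    (htight : Tendsto (fun L => limsup (scaledLog ε μ (K L)ᶜ) atTop) atTop (𝓝 ⊥))
    {F : Set S} (hF : IsClosed F) :
    limsup (scaledLog ε μ F) atTop ≤ -((⨅ z ∈ F, basisRate ℓ z : ENNReal) : EReal) := by
  have hlim := (tendsto_const_nhds (x := -((⨅ z ∈ F, basisRate ℓ z : ENNReal) : EReal))).max htight
  rw [max_bot_right] at hlim
  refine ge_of_tendsto' hlim fun L => ?_
  have hsub : F ⊆ (K L ∩ F) ∪ (K L)ᶜ := fun x hx => by
    by_cases h : x ∈ K L <;> simp [h, hx]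
  refine (limsup_scaledLog_mono hε hsub).trans
    ((limsup_scaledLog_union hε hε0 _ _).trans (max_le_max_right _ ?_))
  refine (limsup_le_neg_iInf_basisRate_of_isCompact hε hε0 hμ hℓ ((hK L).inter_right hF)).trans ?_
  exact EReal.neg_le_neg_iff.2 (EReal.coe_ennreal_le_coe_ennreal_iff.2
    (biInf_mono fun _ h => h.2))

lemma isCompact_basisRate_le [T2Space S] (hε : ∀ j, 0 < ε j)
    (hℓ : ∀ U : countableBasis S, Tendsto (scaledLog ε μ U) atTop (𝓝 (ℓ U)))
    {K : ℕ → Set S} (hK : ∀ L, IsCompact (K L))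
    (htight : Tendsto (fun L => limsup (scaledLog ε μ (K L)ᶜ) atTop) atTop (𝓝 ⊥))
    {M : ENNReal} (hM : M ≠ ⊤) : IsCompact {z | basisRate ℓ z ≤ M} := by
  have hbot : (⊥ : EReal) < -(M : EReal) := by
    rw [bot_lt_iff_ne_bot]
    simpa using hM
  obtain ⟨L, hL⟩ := (htight.eventually_lt_const hbot).exists
  refine (hK L).of_isClosed_subset (lowerSemicontinuous_basisRate.isClosed_preimage M) ?_
  intro x hx
  by_contra hxK
  have h1 : -(M : EReal) ≤ -((⨅ z ∈ (K L)ᶜ, basisRate ℓ z : ENNReal) : EReal) :=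
    EReal.neg_le_neg_iff.2 (EReal.coe_ennreal_le_coe_ennreal_iff.2 ((iInf₂_le x hxK).trans hx))
  exact absurd hL (h1.trans ((neg_iInf_basisRate_le_liminf hε hℓ
    (hK L).isClosed.isOpen_compl).trans (liminf_le_limsup))).not_gt

end LargeDeviations

/-- Proposition 3.1 of the paper, Puhalskii's theorem:
an exponentially tight family of Borel probability measures on a Polish space
is sequentially large-deviations relatively compact. -/
theorem stmt13 {S : Type*} [MetricSpace S] [CompleteSpace S]
    [TopologicalSpace.SeparableSpace S] [MeasurableSpace S] [BorelSpace S]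
    (P : ℝ → Measure S)
    (hP : ∀ ε ∈ Set.Ioc (0:ℝ) 1, IsProbabilityMeasure (P ε))
    (htight : ExpTightFam P) :
    ∀ εk : ℕ → ℝ, (∀ k, εk k ∈ Set.Ioc (0:ℝ) 1) →
      Tendsto εk atTop (nhds 0) →
      ∃ ψ : ℕ → ℕ, StrictMono ψ ∧ ∃ I : S → ENNReal,
        (∀ L : ℝ, 0 < L → IsCompact {z : S | I z ≤ ENNReal.ofReal L}) ∧
        (∀ G : Set S, IsOpen G →
          -(((⨅ z ∈ G, I z) : ENNReal) : EReal)
            ≤ liminf (fun j : ℕ =>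
                (εk (ψ j) : EReal) * ENNReal.log (P (εk (ψ j)) G)) atTop) ∧
        (∀ F : Set S, IsClosed F →
          limsup (fun j : ℕ =>
              (εk (ψ j) : EReal) * ENNReal.log (P (εk (ψ j)) F)) atTop
            ≤ -(((⨅ z ∈ F, I z) : ENNReal) : EReal)) := by
  intro εk hεk hε0
  have : SecondCountableTopology S := UniformSpace.secondCountable_of_separable S
  obtain ⟨K, hK, -, hKtight⟩ := htight
  obtain ⟨ℓ, ψ, hψ, hlim⟩ := CompactSpace.tendsto_subseq
    (fun k (U : countableBasis S) => scaledLog εk (fun k => P (εk k)) U k)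
  have hpos : ∀ j, 0 < εk (ψ j) := fun j => (hεk _).1
  have hzero : Tendsto (fun j => εk (ψ j)) atTop (𝓝 0) := hε0.comp hψ.tendsto_atTop
  have hprob : ∀ j, IsProbabilityMeasure (P (εk (ψ j))) := fun j => hP _ (hεk _)
  have hℓ : ∀ U : countableBasis S, Tendsto
      (scaledLog (fun j => εk (ψ j)) (fun j => P (εk (ψ j))) U) atTop (𝓝 (ℓ U)) :=
    fun U => tendsto_pi_nhds.1 hlim U
  have hwithin : Tendsto (fun j => εk (ψ j)) atTop (𝓝[>] 0) :=
    tendsto_nhdsWithin_iff.2 ⟨hzero, Eventually.of_forall hpos⟩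
  have htight : Tendsto (fun L => limsup
      (scaledLog (fun j => εk (ψ j)) (fun j => P (εk (ψ j))) (K L)ᶜ) atTop) atTop (𝓝 ⊥) :=
    tendsto_of_tendsto_of_tendsto_of_le_of_le tendsto_const_nhds hKtight (fun _ => bot_le)
      fun L => limsup_le_limsup_of_le
        (u := fun ε : ℝ => (ε : EReal) * ENNReal.log (P ε (K L)ᶜ)) hwithin
  exact ⟨ψ, hψ, basisRate ℓ,
    fun L _ => isCompact_basisRate_le hpos hℓ hK htight ENNReal.ofReal_ne_top,
    fun G hG => neg_iInf_basisRate_le_liminf hpos hℓ hG,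
    fun F hF => limsup_le_neg_iInf_basisRate hpos hzero hprob hℓ hK htight hF⟩
end

section
/- Let S be a metric space and let (ν_ε)_{ε ∈ (0,1]} be an exponentially tight family of Borel probability measures on S that satisfies the large deviations principle with rate function I : S → [0,∞] as ε → 0. Let M > 0 and, for each ε, let Φ_ε : S → ℝ be a Borel function with |Φ_ε(z)| ≤ M for all z ∈ S and ∫_S exp(Φ_ε(z)/ε) ν_ε(dz) = 1. Suppose Φ_ε converges, as ε → 0, uniformly on every compact subset of S, to a continuous function Φ : S → ℝ. Then sup_{z ∈ S} ( Φ(z) − I(z) ) = 0. -/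
open MeasureTheory Filter

/-- The family `(P ε)` satisfies the large deviations principle, as `ε → 0⁺`,
with rate function `I : S → [0,∞]`: `I` has compact sublevel sets, the lower
bound holds for open sets and the upper bound holds for closed sets. -/
def LDPfam {S : Type*} [TopologicalSpace S] [MeasurableSpace S]
    (P : ℝ → Measure S) (I : S → ENNReal) : Prop :=
  (∀ L : ℝ, 0 < L → IsCompact {z : S | I z ≤ ENNReal.ofReal L}) ∧
  (∀ G : Set S, IsOpen G →
    -(((⨅ z ∈ G, I z) : ENNReal) : EReal)
      ≤ liminf (fun ε : ℝ => (ε : EReal) * ENNReal.log (P ε G))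
          (nhdsWithin 0 (Set.Ioi 0))) ∧
  (∀ F : Set S, IsClosed F →
    limsup (fun ε : ℝ => (ε : EReal) * ENNReal.log (P ε F))
        (nhdsWithin 0 (Set.Ioi 0))
      ≤ -(((⨅ z ∈ F, I z) : ENNReal) : EReal))

lemma ENNReal.le_ofReal_exp_of_mul_log_le {ε a : ℝ} (hε : 0 < ε) {x : ENNReal}
    (h : (ε : EReal) * ENNReal.log x ≤ a) : x ≤ ENNReal.ofReal (Real.exp (a / ε)) := by
  rw [← ENNReal.exp_log x, ← EReal.exp_coe, EReal.exp_le_exp_iff, EReal.coe_div,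
    EReal.le_div_iff_mul_le (by exact_mod_cast hε) (EReal.coe_ne_top ε), mul_comm]
  exact h

lemma ENNReal.ofReal_exp_le_of_le_mul_log {ε a : ℝ} (hε : 0 < ε) {x : ENNReal}
    (h : (a : EReal) ≤ (ε : EReal) * ENNReal.log x) : ENNReal.ofReal (Real.exp (a / ε)) ≤ x := by
  rw [← ENNReal.exp_log x, ← EReal.exp_coe, EReal.exp_le_exp_iff, EReal.coe_div,
    EReal.div_le_iff_le_mul (by exact_mod_cast hε) (EReal.coe_ne_top ε)]
  exact h

lemma ENNReal.ofReal_exp_div_mul (a b ε : ℝ) :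
    ENNReal.ofReal (Real.exp (a / ε)) * ENNReal.ofReal (Real.exp (b / ε))
      = ENNReal.ofReal (Real.exp ((a + b) / ε)) := by
  rw [← ENNReal.ofReal_mul (Real.exp_nonneg _), ← Real.exp_add, add_div]

lemma eventually_lt_exp_div (C : ℝ) {δ : ℝ} (hδ : 0 < δ) :
    ∀ᶠ ε in nhdsWithin (0 : ℝ) (Set.Ioi 0), C < Real.exp (δ / ε) := by
  have h : Tendsto (fun ε : ℝ => Real.exp (δ / ε)) (nhdsWithin 0 (Set.Ioi 0)) atTop := by
    simp only [div_eq_mul_inv]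
    exact Real.tendsto_exp_atTop.comp (tendsto_inv_nhdsGT_zero.const_mul_atTop hδ)
  exact h.eventually_gt_atTop C

lemma ExpTightFam.exists_isCompact {S : Type*} [TopologicalSpace S] [MeasurableSpace S]
    {P : ℝ → Measure S} (h : ExpTightFam P) (c : ℝ) :
    ∃ K : Set S, IsCompact K ∧ ∀ᶠ ε in nhdsWithin (0 : ℝ) (Set.Ioi 0),
      P ε Kᶜ ≤ ENNReal.ofReal (Real.exp (c / ε)) := by
  obtain ⟨K, hK, -, hlim⟩ := h
  obtain ⟨L, hL⟩ := (hlim.eventually_lt_const (EReal.bot_lt_coe c)).exists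
  refine ⟨K L, hK L, ?_⟩
  filter_upwards [eventually_lt_of_limsup_lt hL, self_mem_nhdsWithin] with ε h hε
  exact ENNReal.le_ofReal_exp_of_mul_log_le hε h.le

lemma LDPfam.eventually_ofReal_exp_le {S : Type*} [TopologicalSpace S] [MeasurableSpace S]
    {P : ℝ → Measure S} {I : S → ENNReal} (h : LDPfam P I) {G : Set S} (hG : IsOpen G)
    {z : S} (hz : z ∈ G) {c : ℝ} (hc : (c : EReal) < -(I z : EReal)) :
    ∀ᶠ ε in nhdsWithin (0 : ℝ) (Set.Ioi 0), ENNReal.ofReal (Real.exp (c / ε)) ≤ P ε G := by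
  have hle : -(I z : EReal) ≤ -(((⨅ z ∈ G, I z) : ENNReal) : EReal) :=
    EReal.neg_le_neg_iff.2 (EReal.coe_ennreal_le_coe_ennreal_iff.2 (iInf₂_le z hz))
  filter_upwards [eventually_lt_of_lt_liminf (hc.trans_le (hle.trans (h.2.1 G hG))),
    self_mem_nhdsWithin] with ε h hε
  exact ENNReal.ofReal_exp_le_of_le_mul_log hε h.le

lemma LDPfam.eventually_le_ofReal_exp {S : Type*} [TopologicalSpace S] [MeasurableSpace S]
    {P : ℝ → Measure S} {I : S → ENNReal} (h : LDPfam P I) {F : Set S} (hF : IsClosed F)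
    {b c : ℝ} (hb : ∀ z ∈ F, ((-b : ℝ) : EReal) ≤ I z) (hc : b < c) :
    ∀ᶠ ε in nhdsWithin (0 : ℝ) (Set.Ioi 0), P ε F ≤ ENNReal.ofReal (Real.exp (c / ε)) := by
  have hinf : ENNReal.ofReal (-b) ≤ ⨅ z ∈ F, I z := by
    refine le_iInf₂ fun z hz => ?_
    rw [← EReal.coe_ennreal_le_coe_ennreal_iff, EReal.coe_ennreal_ofReal,
      EReal.coe_strictMono.monotone.map_max]
    exact max_le (hb z hz) (EReal.coe_ennreal_nonneg _)
  have hle : -(((⨅ z ∈ F, I z) : ENNReal) : EReal) ≤ (b : EReal) := by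
    rw [EReal.neg_le, ← EReal.coe_neg]
    refine le_trans ?_ (EReal.coe_ennreal_le_coe_ennreal_iff.2 hinf)
    rw [EReal.coe_ennreal_ofReal]
    exact_mod_cast le_max_left _ _
  filter_upwards [eventually_lt_of_limsup_lt
    (((h.2.2 F hF).trans hle).trans_lt (EReal.coe_lt_coe_iff.2 hc)),
    self_mem_nhdsWithin] with ε h hε
  exact ENNReal.le_ofReal_exp_of_mul_log_le hε h.le

lemma setLIntegral_exp_div_le {S : Type*} [MeasurableSpace S] {μ : Measure S} {A : Set S}
    (hA : MeasurableSet A) {f : S → ℝ} {ε a b : ℝ} (hε : 0 < ε) (hf : ∀ z ∈ A, f z ≤ a)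
    (hμ : μ A ≤ ENNReal.ofReal (Real.exp (b / ε))) :
    ∫⁻ z in A, ENNReal.ofReal (Real.exp (f z / ε)) ∂μ
      ≤ ENNReal.ofReal (Real.exp ((a + b) / ε)) := by
  calc ∫⁻ z in A, ENNReal.ofReal (Real.exp (f z / ε)) ∂μ
      ≤ ∫⁻ _ in A, ENNReal.ofReal (Real.exp (a / ε)) ∂μ := by
        refine setLIntegral_mono' hA fun z hz => ?_
        gcongr
        exact hf z hz
    _ = ENNReal.ofReal (Real.exp (a / ε)) * μ A := setLIntegral_const _ _
    _ ≤ _ := by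
        rw [← ENNReal.ofReal_exp_div_mul]
        gcongr

section Varadhan

variable {S : Type*} [MetricSpace S] [MeasurableSpace S] [BorelSpace S]
  {ν : ℝ → Measure S} {I : S → ENNReal} {M : ℝ} {Φε : ℝ → S → ℝ} {Φ : S → ℝ}

/-- If the exponential integrals stay below `1`, then `Φ ≤ I` pointwise. -/
lemma LDPfam.le_rate_of_lintegral_exp_le_one (htight : ExpTightFam ν) (hLDP : LDPfam ν I)
    (hint : ∀ᶠ ε in nhdsWithin (0 : ℝ) (Set.Ioi 0),
      ∫⁻ z, ENNReal.ofReal (Real.exp (Φε ε z / ε)) ∂(ν ε) ≤ 1)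
    (hconv : ∀ K : Set S, IsCompact K →
      TendstoUniformlyOn Φε Φ (nhdsWithin 0 (Set.Ioi 0)) K)
    (hΦcont : Continuous Φ) (z : S) : (Φ z : EReal) ≤ I z := by
  by_contra! hlt
  obtain ⟨r, hIr, hr⟩ := EReal.lt_iff_exists_real_btwn.1 hlt
  have hr : r < Φ z := EReal.coe_lt_coe_iff.1 hr
  obtain ⟨δ, hδ⟩ : ∃ δ, δ = (Φ z - r) / 4 := ⟨_, rfl⟩
  have hδpos : 0 < δ := by linarith
  set G : Set S := {y | Φ z - δ < Φ y}
  have hG : IsOpen G := isOpen_lt continuous_const hΦcont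
  have hzG : z ∈ G := show Φ z - δ < Φ z by linarith
  have hc : ((-r : ℝ) : EReal) < -(I z : EReal) := by
    rw [EReal.coe_neg]
    exact EReal.neg_lt_neg_iff.2 hIr
  obtain ⟨K, hK, hKc⟩ := htight.exists_isCompact (-r - δ)
  obtain ⟨ε, hνG, hνK, hu, hint, hlarge, hε⟩ := ((hLDP.eventually_ofReal_exp_le hG hzG hc).and
    (hKc.and ((Metric.tendstoUniformlyOn_iff.1 (hconv K hK) δ hδpos).and
      (hint.and ((eventually_lt_exp_div 2 hδpos).and self_mem_nhdsWithin))))).exists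
  replace hε : 0 < ε := hε
  set c := ENNReal.ofReal (Real.exp ((Φ z - 2 * δ) / ε))
  have hGK : c * ν ε (G ∩ K) ≤ 1 := by
    rw [← setLIntegral_const]
    refine le_trans ?_ ((setLIntegral_le_lintegral (G ∩ K) _).trans hint)
    refine setLIntegral_mono' (hG.measurableSet.inter hK.measurableSet) fun y hy => ?_
    have h1 : Φ z - δ < Φ y := hy.1
    have h2 := (abs_lt.1 (Real.dist_eq _ _ ▸ hu y hy.2)).2
    refine ENNReal.ofReal_le_ofReal (Real.exp_le_exp.2 ?_)
    gcongr
    linarith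
  have hsum : ENNReal.ofReal (Real.exp (2 * δ / ε))
      ≤ 1 + ENNReal.ofReal (Real.exp (δ / ε)) :=
    calc ENNReal.ofReal (Real.exp (2 * δ / ε))
        = c * ENNReal.ofReal (Real.exp (-r / ε)) := by
          rw [ENNReal.ofReal_exp_div_mul]
          congr 3
          linarith
      _ ≤ c * (ν ε (G ∩ K) + ν ε Kᶜ) := by
          gcongr
          refine hνG.trans ((measure_mono fun y hy => ?_).trans (measure_union_le _ _))
          by_cases hyK : y ∈ K
          exacts [Or.inl ⟨hy, hyK⟩, Or.inr hyK]
      _ ≤ 1 + c * ENNReal.ofReal (Real.exp ((-r - δ) / ε)) := by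
          rw [mul_add]
          gcongr
      _ = 1 + ENNReal.ofReal (Real.exp (δ / ε)) := by
          rw [ENNReal.ofReal_exp_div_mul]
          congr 4
          linarith
  rw [← ENNReal.ofReal_one, ← ENNReal.ofReal_add zero_le_one (Real.exp_nonneg _),
    ENNReal.ofReal_le_ofReal_iff (by positivity), two_mul, add_div, Real.exp_add] at hsum
  nlinarith

/-- If the exponential integrals stay above `1`, then `Φ - I` is not bounded away from `0`
from below. -/
lemma LDPfam.exists_lt_of_one_le_lintegral_exp (htight : ExpTightFam ν) (hLDP : LDPfam ν I)
    (hbdd : ∀ᶠ ε in nhdsWithin (0 : ℝ) (Set.Ioi 0), ∀ z, |Φε ε z| ≤ M)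
    (hint : ∀ᶠ ε in nhdsWithin (0 : ℝ) (Set.Ioi 0),
      1 ≤ ∫⁻ z, ENNReal.ofReal (Real.exp (Φε ε z / ε)) ∂(ν ε))
    (hconv : ∀ K : Set S, IsCompact K →
      TendstoUniformlyOn Φε Φ (nhdsWithin 0 (Set.Ioi 0)) K)
    (hΦcont : Continuous Φ) {η : ℝ} (hη : 0 < η) :
    ∃ z, (I z : EReal) < ((Φ z + η : ℝ) : EReal) := by
  by_contra! hI
  obtain ⟨δ, hδ⟩ : ∃ δ, δ = η / 4 := ⟨_, rfl⟩
  have hδpos : 0 < δ := by linarith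
  have hΦbdd : ∀ z, |Φ z| ≤ M := fun z => by
    have ht := (hconv {z} isCompact_singleton).tendsto_at (Set.mem_singleton z)
    exact le_of_tendsto ht.abs (hbdd.mono fun ε h => h z)
  obtain ⟨N, hN⟩ := exists_nat_gt (2 * M / δ)
  rw [div_lt_iff₀ hδpos] at hN
  set F : Fin N → Set S := fun j => {y | -M + j * δ ≤ Φ y ∧ Φ y ≤ -M + (j + 1) * δ}
  have hF : ∀ j, IsClosed (F j) := fun j =>
    (isClosed_le continuous_const hΦcont).inter (isClosed_le hΦcont continuous_const)
  have hcover : ∀ y, ∃ j, y ∈ F j := fun y => by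
    obtain ⟨h1, h2⟩ := abs_le.1 (hΦbdd y)
    have h0 : 0 ≤ (Φ y + M) / δ := div_nonneg (by linarith) hδpos.le
    have hle := Nat.floor_le h0
    have hlt := Nat.lt_floor_add_one ((Φ y + M) / δ)
    rw [le_div_iff₀ hδpos] at hle
    rw [div_lt_iff₀ hδpos] at hlt
    refine ⟨⟨⌊(Φ y + M) / δ⌋₊, ?_⟩, ?_, ?_⟩
    · rw [Nat.floor_lt h0, div_lt_iff₀ hδpos]
      linarith
    · dsimp only
      linarith
    · dsimp only
      linarith
  obtain ⟨K, hK, hKc⟩ := htight.exists_isCompact (-M - δ)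
  have hνF : ∀ j : Fin N, ∀ᶠ ε in nhdsWithin (0 : ℝ) (Set.Ioi 0),
      ν ε (F j) ≤ ENNReal.ofReal (Real.exp ((M - j * δ - 3 * δ) / ε)) := fun j => by
    refine hLDP.eventually_le_ofReal_exp (hF j) (b := M - j * δ - 4 * δ) (fun z hz => ?_)
      (by linarith)
    refine le_trans (EReal.coe_le_coe_iff.2 ?_) (hI z)
    linarith [hz.1]
  obtain ⟨ε, hνF, hνK, hu, hbdd, hint, hlarge, hε⟩ := ((eventually_all.2 hνF).and
    (hKc.and ((Metric.tendstoUniformlyOn_iff.1 (hconv K hK) δ hδpos).and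
      (hbdd.and (hint.and
        ((eventually_lt_exp_div (N + 1) hδpos).and self_mem_nhdsWithin)))))).exists
  replace hε : 0 < ε := hε
  have hpiece : ∀ j, ∫⁻ z in F j ∩ K, ENNReal.ofReal (Real.exp (Φε ε z / ε)) ∂(ν ε)
      ≤ ENNReal.ofReal (Real.exp (-δ / ε)) := fun j => by
    convert setLIntegral_exp_div_le ((hF j).measurableSet.inter hK.measurableSet) hε
      (a := -M + (j + 2) * δ) (fun z hz => ?_)
      ((measure_mono Set.inter_subset_left).trans (hνF j)) using 4
    · ring
    · have h1 := (abs_lt.1 (Real.dist_eq _ _ ▸ hu z hz.2)).1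
      linarith [hz.1.2]
  have htail : ∫⁻ z in Kᶜ, ENNReal.ofReal (Real.exp (Φε ε z / ε)) ∂(ν ε)
      ≤ ENNReal.ofReal (Real.exp (-δ / ε)) := by
    convert setLIntegral_exp_div_le hK.measurableSet.compl hε
      (fun z _ => (abs_le.1 (hbdd z)).2) hνK using 4
    ring
  have hbulk : ∫⁻ z in K, ENNReal.ofReal (Real.exp (Φε ε z / ε)) ∂(ν ε)
      ≤ N * ENNReal.ofReal (Real.exp (-δ / ε)) :=
    calc ∫⁻ z in K, ENNReal.ofReal (Real.exp (Φε ε z / ε)) ∂(ν ε)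
        ≤ ∫⁻ z in ⋃ j, F j ∩ K, ENNReal.ofReal (Real.exp (Φε ε z / ε)) ∂(ν ε) :=
          lintegral_mono_set fun y hy =>
            Set.mem_iUnion.2 ((hcover y).imp fun j hj => ⟨hj, hy⟩)
      _ ≤ ∑ j, ∫⁻ z in F j ∩ K, ENNReal.ofReal (Real.exp (Φε ε z / ε)) ∂(ν ε) := by
          rw [← tsum_fintype (L := .unconditional _)]
          exact lintegral_iUnion_le _ _
      _ ≤ ∑ _j : Fin N, ENNReal.ofReal (Real.exp (-δ / ε)) :=
          Finset.sum_le_sum fun j _ => hpiece j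
      _ = N * ENNReal.ofReal (Real.exp (-δ / ε)) := by simp
  have hsum : (1 : ENNReal) ≤ ENNReal.ofReal ((N + 1) * Real.exp (-δ / ε)) :=
    calc (1 : ENNReal)
        ≤ N * ENNReal.ofReal (Real.exp (-δ / ε)) + ENNReal.ofReal (Real.exp (-δ / ε)) := by
          refine hint.trans ?_
          rw [← lintegral_add_compl _ hK.measurableSet]
          gcongr
      _ = ENNReal.ofReal ((N + 1) * Real.exp (-δ / ε)) := by
          rw [ENNReal.ofReal_mul (by positivity), ENNReal.ofReal_add (by positivity) zero_le_one,
            ENNReal.ofReal_natCast, ENNReal.ofReal_one, add_mul, one_mul]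
  rw [ENNReal.one_le_ofReal, neg_div, Real.exp_neg, ← div_eq_mul_inv,
    one_le_div (Real.exp_pos _)] at hsum
  linarith

end Varadhan

/-- Lemma 4.3 of the paper, a Varadhan-type identification
lemma: if `∫ exp(Φ_ε/ε) dν_ε = 1`, `|Φ_ε| ≤ M`, `Φ_ε → Φ` uniformly on
compact sets with `Φ` continuous, and `(ν_ε)` is exponentially tight and obeys
the LDP with rate function `I`, then `sup_z (Φ(z) − I(z)) = 0`. -/
theorem stmt15 {S : Type*} [MetricSpace S] [MeasurableSpace S] [BorelSpace S]
    (ν : ℝ → Measure S)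
    (hν : ∀ ε ∈ Set.Ioc (0:ℝ) 1, IsProbabilityMeasure (ν ε))
    (htight : ExpTightFam ν)
    (I : S → ENNReal) (hLDP : LDPfam ν I)
    (M : ℝ) (hM : 0 < M)
    (Φε : ℝ → S → ℝ) (Φ : S → ℝ)
    (hΦεmeas : ∀ ε ∈ Set.Ioc (0:ℝ) 1, Measurable (Φε ε))
    (hΦεbdd : ∀ ε ∈ Set.Ioc (0:ℝ) 1, ∀ z : S, |Φε ε z| ≤ M)
    (hΦεint : ∀ ε ∈ Set.Ioc (0:ℝ) 1, ∫ z, Real.exp (Φε ε z / ε) ∂(ν ε) = 1)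
    (hconv : ∀ K : Set S, IsCompact K →
      TendstoUniformlyOn Φε Φ (nhdsWithin 0 (Set.Ioi 0)) K)
    (hΦcont : Continuous Φ) :
    (⨆ z : S, ((Φ z : EReal) - (I z : EReal))) = 0 := by
  have hIoc : ∀ᶠ ε in nhdsWithin (0 : ℝ) (Set.Ioi 0), ε ∈ Set.Ioc (0 : ℝ) 1 :=
    Ioc_mem_nhdsGT zero_lt_one
  have hint : ∀ᶠ ε in nhdsWithin (0 : ℝ) (Set.Ioi 0),
      ∫⁻ z, ENNReal.ofReal (Real.exp (Φε ε z / ε)) ∂(ν ε) = 1 := by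
    filter_upwards [hIoc] with ε hε
    have h1 := hΦεint ε hε
    rw [← ofReal_integral_eq_lintegral_ofReal
      (Integrable.of_integral_ne_zero (by rw [h1]; exact one_ne_zero))
      (ae_of_all _ fun z => Real.exp_nonneg _), h1, ENNReal.ofReal_one]
  apply le_antisymm
  · refine iSup_le fun z => ?_
    rw [EReal.sub_nonpos]
    exact hLDP.le_rate_of_lintegral_exp_le_one htight (hint.mono fun _ h => h.le) hconv hΦcont z
  · by_contra! hlt
    obtain ⟨c, hc, hc0⟩ := EReal.lt_iff_exists_real_btwn.1 hlt
    have hc0 : c < 0 := by exact_mod_cast hc0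
    obtain ⟨z, hz⟩ := hLDP.exists_lt_of_one_le_lintegral_exp htight
      (hIoc.mono hΦεbdd) (hint.mono fun _ h => h.ge) hconv hΦcont (neg_pos.2 hc0)
    have hzc : (Φ z : EReal) - I z < c :=
      (le_iSup (fun z => (Φ z : EReal) - (I z : EReal)) z).trans_lt hc
    generalize (I z : EReal) = x at hz hzc
    induction x with
    | bot => simp at hzc
    | top => simp at hz
    | coe x =>
      norm_cast at hz hzc
      linarith
end
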